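/- arXiv:1507.04187 — 2 statements merged into one kernel-verified Lean document; each statement's English description precedes it below -/
import Mathlib

section
/- Let d ≥ 1, let μ ∈ P_1(ℝ^d) be centered and not supported on an affine hyperplane, and let ρ̄ ∈ P_1(ℝ^d) minimize E(·) + T(·,μ) over P_1(ℝ^d). Suppose u : ℝ^d → ℝ ∪ {+∞} is a convex, lower semicontinuous, proper function such that T(ρ̄,μ) = ∫ u dρ̄ + ∫ u* dμ (both integrals finite), where u*(y) := sup_{x ∈ ℝ^d} (⟨x,y⟩ − u(x)) is the Legendre transform, and suppose ρ̄ is absolutely continuous with density f satisfying u(x) = +∞ for a.e. x with f(x) = 0. Then there exists a constant c > 0 such that f(x) = c·e^{−u(x)} for Lebesgue-a.e. x ∈ ℝ^d. -/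
open MeasureTheory Real Filter Topology
open scoped ENNReal RealInnerProductSpace

noncomputable section

/-- `d`-dimensional Euclidean space. -/
abbrev Ed (d : ℕ) := EuclideanSpace ℝ (Fin d)

open Classical in
/-- The entropy `E(ρ) = ∫ f ln f dx` (extended-real-valued, computed as positive part minus
negative part of the integral of `f ln f`, where `f` is the density), and `+∞` if `ρ` is not
absolutely continuous w.r.t. Lebesgue measure. -/
def entropy {d : ℕ} (ρ : Measure (Ed d)) : EReal :=
  if ρ ≪ (volume : Measure (Ed d)) then
    ((∫⁻ x, ENNReal.ofReal ((ρ.rnDeriv volume x).toReal *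
        Real.log (ρ.rnDeriv volume x).toReal) : ℝ≥0∞) : EReal)
      - ((∫⁻ x, ENNReal.ofReal (-((ρ.rnDeriv volume x).toReal *
        Real.log (ρ.rnDeriv volume x).toReal)) : ℝ≥0∞) : EReal)
  else ⊤

/-- The (extended-real-valued) integral `∫ ⟨x,y⟩ dγ(x,y)`: positive part minus negative part. -/
def pairInt {d : ℕ} (γ : Measure (Ed d × Ed d)) : EReal :=
  ((∫⁻ p, ENNReal.ofReal (⟪p.1, p.2⟫ : ℝ) ∂γ : ℝ≥0∞) : EReal)
    - ((∫⁻ p, ENNReal.ofReal (-(⟪p.1, p.2⟫ : ℝ)) ∂γ : ℝ≥0∞) : EReal)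

/-- Transport plans: probability measures on the product with marginals `ρ` and `μ`. -/
def Couplings {d : ℕ} (ρ μ : Measure (Ed d)) : Set (Measure (Ed d × Ed d)) :=
  {γ | IsProbabilityMeasure γ ∧ γ.fst = ρ ∧ γ.snd = μ}

/-- The maximal correlation functional `T(ρ,μ) = sup { ∫⟨x,y⟩ dγ : γ ∈ Π(ρ,μ) }`. -/
def maxCorr {d : ℕ} (ρ μ : Measure (Ed d)) : EReal :=
  ⨆ γ ∈ Couplings ρ μ, pairInt γ

/-- `ρ` has finite first moment. -/
def FirstMoment {d : ℕ} (ρ : Measure (Ed d)) : Prop := Integrable (fun x => ‖x‖) ρ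

/-- `ρ` is centered: its barycenter is `0`. -/
def Centered {d : ℕ} (ρ : Measure (Ed d)) : Prop := (∫ x, x ∂ρ) = 0

/-- Weak convergence of measures: convergence of integrals of bounded continuous functions. -/
def WeakConv {d : ℕ} (ρs : ℕ → Measure (Ed d)) (ρ : Measure (Ed d)) : Prop :=
  ∀ f : BoundedContinuousFunction (Ed d) ℝ,
    Tendsto (fun n => ∫ x, f x ∂(ρs n)) atTop (𝓝 (∫ x, f x ∂ρ))

/-- Convexity for extended-real-valued functions on `Ed d`. -/
def EConvexOn {d : ℕ} (u : Ed d → EReal) : Prop :=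
  ∀ x y : Ed d, ∀ a b : ℝ, 0 ≤ a → 0 ≤ b → a + b = 1 →
    u (a • x + b • y) ≤ (a : EReal) * u x + (b : EReal) * u y

/-- `e^{-t}` for `t ∈ ℝ ∪ {+∞}`, with `e^{-∞} = 0`. -/
def expNegE (t : EReal) : ℝ := if t = ⊤ then 0 else Real.exp (-t.toReal)

/-- The Legendre transform `u*(y) = sup_x (⟨x,y⟩ - u(x))`. -/
def legendre {d : ℕ} (u : Ed d → EReal) (y : Ed d) : EReal :=
  ⨆ x : Ed d, (((⟪x, y⟫ : ℝ) : EReal) - u x)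

/-- The essential continuity of a convex l.s.c. function `u : ℝ^d → ℝ ∪ {+∞}`:
`u` tends to `+∞` at `H^{d-1}`-a.e. point of the boundary of its domain. -/
def EssentiallyContinuous {d : ℕ} (u : Ed d → EReal) : Prop :=
  μH[(d : ℝ) - 1] {x : Ed d | x ∈ frontier {y | u y < ⊤} ∧ u x < ⊤} = 0

/-- The pointwise inequality behind nonnegativity of the relative entropy. -/
theorem relEntropy_integrand_nonneg {a b : ℝ} (ha : 0 ≤ a) (hb : 0 < b) :
    0 ≤ a * log a - a * log b - a + b := by
  rcases ha.eq_or_lt with rfl | ha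
  · simpa using hb.le
  · have h := log_le_sub_one_of_pos (div_pos hb ha)
    rw [log_div hb.ne' ha.ne'] at h
    have h' := mul_le_mul_of_nonneg_left h ha.le
    have : a * (b / a - 1) = b - a := by field_simp
    linarith

/-- The equality case of `relEntropy_integrand_nonneg`. -/
theorem eq_of_relEntropy_integrand_eq_zero {a b : ℝ} (ha : 0 ≤ a) (hb : 0 < b)
    (h : a * log a - a * log b - a + b = 0) : a = b := by
  rcases ha.eq_or_lt with rfl | ha
  · simp at h
    exact h.symm
  · by_contra hab
    have hne : b / a ≠ 1 := fun h1 => hab ((div_eq_one_iff_eq ha.ne').1 h1).symm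
    have hlt := log_lt_sub_one_of_pos (div_pos hb ha) hne
    rw [log_div hb.ne' ha.ne'] at hlt
    have h' := mul_lt_mul_of_pos_left hlt ha
    have : a * (b / a - 1) = b - a := by field_simp
    linarith

section ExtendedIntegral

variable {α : Type*} [MeasurableSpace α] {ν : Measure α}

theorem posPart_sub_negPart_eq_integral {h : α → ℝ} (hh : Integrable h ν) :
    ((∫⁻ x, ENNReal.ofReal (h x) ∂ν : ℝ≥0∞) : EReal)
      - ((∫⁻ x, ENNReal.ofReal (-(h x)) ∂ν : ℝ≥0∞) : EReal) = ((∫ x, h x ∂ν : ℝ) : EReal) := by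
  rw [integral_eq_lintegral_pos_part_sub_lintegral_neg_part hh, EReal.coe_sub,
    EReal.coe_ennreal_toReal hh.lintegral_lt_top.ne,
    EReal.coe_ennreal_toReal (x := ∫⁻ x, ENNReal.ofReal (-(h x)) ∂ν) hh.neg.lintegral_lt_top.ne]

theorem posPart_sub_negPart_le_integral {h k : α → ℝ} (hk : Integrable k ν)
    (hle : ∀ᵐ x ∂ν, h x ≤ k x) :
    ((∫⁻ x, ENNReal.ofReal (h x) ∂ν : ℝ≥0∞) : EReal)
      - ((∫⁻ x, ENNReal.ofReal (-(h x)) ∂ν : ℝ≥0∞) : EReal) ≤ ((∫ x, k x ∂ν : ℝ) : EReal) := by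
  rw [← posPart_sub_negPart_eq_integral hk]
  apply EReal.sub_le_sub <;> apply EReal.coe_ennreal_le_coe_ennreal_iff.2 <;>
    apply lintegral_mono_ae <;> filter_upwards [hle] with x hx
  · exact ENNReal.ofReal_le_ofReal hx
  · exact ENNReal.ofReal_le_ofReal (neg_le_neg hx)

theorem integrable_of_posPart_sub_negPart_ne_top {h k : α → ℝ}
    (hh : AEStronglyMeasurable h ν) (hk : Integrable k ν) (hle : ∀ᵐ x ∂ν, k x ≤ h x)
    (hne : ((∫⁻ x, ENNReal.ofReal (h x) ∂ν : ℝ≥0∞) : EReal)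
      - ((∫⁻ x, ENNReal.ofReal (-(h x)) ∂ν : ℝ≥0∞) : EReal) ≠ ⊤) : Integrable h ν := by
  have hneg : ∫⁻ x, ENNReal.ofReal (-(h x)) ∂ν ≠ ⊤ := by
    refine ((lintegral_mono_ae ?_).trans_lt hk.neg.lintegral_lt_top).ne
    filter_upwards [hle] with x hx
    exact ENNReal.ofReal_le_ofReal (neg_le_neg hx)
  have hpos : ∫⁻ x, ENNReal.ofReal (h x) ∂ν ≠ ⊤ := by
    intro htop
    apply hne
    rw [htop, ← EReal.coe_ennreal_toReal hneg]
    simp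
  refine ⟨hh, ?_⟩
  have hsum : ∀ x, ‖h x‖ₑ = ENNReal.ofReal (h x) + ENNReal.ofReal (-(h x)) := by
    intro x
    rw [← ofReal_norm, Real.norm_eq_abs]
    rcases le_total 0 (h x) with h0 | h0
    · simp [abs_of_nonneg h0, ENNReal.ofReal_of_nonpos (neg_nonpos.2 h0)]
    · simp [abs_of_nonpos h0, ENNReal.ofReal_of_nonpos h0]
  rw [HasFiniteIntegral, lintegral_congr hsum,
    lintegral_add_left' hh.aemeasurable.ennreal_ofReal]
  exact ENNReal.add_lt_top.2 ⟨hpos.lt_top, hneg.lt_top⟩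

theorem isProbabilityMeasure_withDensity_ofReal {g : α → ℝ} (hg0 : ∀ x, 0 ≤ g x)
    (hgi : Integrable g ν) (hg1 : ∫ x, g x ∂ν = 1) :
    IsProbabilityMeasure (ν.withDensity fun x => ENNReal.ofReal (g x)) := by
  constructor
  rw [withDensity_apply _ MeasurableSet.univ, Measure.restrict_univ,
    ← ofReal_integral_eq_lintegral_ofReal hgi (Eventually.of_forall hg0), hg1, ENNReal.ofReal_one]

theorem integrable_withDensity_ofReal_iff {g h : α → ℝ} (hg : Measurable g) (hg0 : ∀ x, 0 ≤ g x) :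
    Integrable h (ν.withDensity fun x => ENNReal.ofReal (g x)) ↔
      Integrable (fun x => g x * h x) ν := by
  rw [integrable_withDensity_iff_integrable_smul' hg.ennreal_ofReal (by simp)]
  simp [ENNReal.toReal_ofReal (hg0 _)]

theorem integral_withDensity_ofReal {g : α → ℝ} (hg : Measurable g) (hg0 : ∀ x, 0 ≤ g x)
    (h : α → ℝ) :
    ∫ x, h x ∂(ν.withDensity fun x => ENNReal.ofReal (g x)) = ∫ x, g x * h x ∂ν := by
  rw [integral_withDensity_eq_integral_toReal_smul hg.ennreal_ofReal (by simp)]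
  simp [ENNReal.toReal_ofReal (hg0 _)]

end ExtendedIntegral

theorem entropy_withDensity_ofReal {d : ℕ} {g : Ed d → ℝ} (hg : Measurable g)
    (hg0 : ∀ x, 0 ≤ g x) :
    entropy (volume.withDensity fun x => ENNReal.ofReal (g x)) =
      ((∫⁻ x, ENNReal.ofReal (g x * log (g x)) : ℝ≥0∞) : EReal)
      - ((∫⁻ x, ENNReal.ofReal (-(g x * log (g x))) : ℝ≥0∞) : EReal) := by
  have h := Measure.rnDeriv_withDensity (volume : Measure (Ed d)) hg.ennreal_ofReal
  rw [entropy, if_pos (withDensity_absolutelyContinuous _ _)]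
  congr 2 <;> apply lintegral_congr_ae <;> filter_upwards [h] with x hx <;>
    rw [hx, ENNReal.toReal_ofReal (hg0 x)]

/-- A finite first moment bounds the negative part of `f log f`, so finite entropy means that
`f log f` is integrable. -/
theorem integrable_mul_log_of_entropy_ne_top {d : ℕ} {f : Ed d → ℝ} (hf : Measurable f)
    (hf0 : ∀ x, 0 ≤ f x) (hfi : Integrable f) (hf1 : Integrable fun x => f x * ‖x‖)
    (hne : entropy (volume.withDensity fun x => ENNReal.ofReal (f x)) ≠ ⊤) :
    Integrable fun x => f x * log (f x) := by
  rw [entropy_withDensity_ofReal hf hf0] at hne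
  set r : ℝ := d + 1
  have hr : 0 ≤ r := by positivity
  have hJ : Integrable fun x : Ed d => (1 + ‖x‖) ^ (-r) :=
    integrable_one_add_norm (by simp [r])
  refine integrable_of_posPart_sub_negPart_ne_top
    (hf.mul (measurable_log.comp hf)).aestronglyMeasurable
    (((hf1.const_mul (-r)).add hfi).sub hJ) (Eventually.of_forall fun x => ?_) hne
  have hx : 0 < 1 + ‖x‖ := by positivity
  have h := relEntropy_integrand_nonneg (hf0 x) (rpow_pos_of_pos hx (-r))
  rw [log_rpow hx] at h
  have hlog : log (1 + ‖x‖) ≤ ‖x‖ := by linarith [log_le_sub_one_of_pos hx]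
  have := mul_le_mul_of_nonneg_left hlog (mul_nonneg hr (hf0 x))
  simp only [Pi.add_apply, Pi.sub_apply]
  linarith

/-- Weak duality for the maximal correlation problem. -/
theorem maxCorr_le_integral_add_integral_legendre {d : ℕ} {ρ μ : Measure (Ed d)} {u : Ed d → EReal}
    (hubot : ∀ x, u x ≠ ⊥) (huae : ∀ᵐ x ∂ρ, u x ≠ ⊤)
    (huint : Integrable (fun x => (u x).toReal) ρ)
    (hustarae : ∀ᵐ y ∂μ, legendre u y ≠ ⊤)
    (hustarint : Integrable (fun y => (legendre u y).toReal) μ) :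
    maxCorr ρ μ ≤
      (((∫ x, (u x).toReal ∂ρ) + ∫ y, (legendre u y).toReal ∂μ : ℝ) : EReal) := by
  refine iSup₂_le fun γ hγ => ?_
  obtain ⟨-, rfl, rfl⟩ := hγ
  have h1 : Integrable (fun p : Ed d × Ed d => (u p.1).toReal) γ :=
    huint.comp_measurable measurable_fst
  have h2 : Integrable (fun p : Ed d × Ed d => (legendre u p.2).toReal) γ :=
    hustarint.comp_measurable measurable_snd
  have e1 : ∫ x, (u x).toReal ∂γ.fst = ∫ p, (u p.1).toReal ∂γ :=
    integral_map measurable_fst.aemeasurable huint.aestronglyMeasurable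
  have e2 : ∫ y, (legendre u y).toReal ∂γ.snd = ∫ p, (legendre u p.2).toReal ∂γ :=
    integral_map measurable_snd.aemeasurable hustarint.aestronglyMeasurable
  rw [e1, e2, ← integral_add h1 h2]
  refine posPart_sub_negPart_le_integral (h1.add h2) ?_
  filter_upwards [ae_of_ae_map measurable_fst.aemeasurable huae,
    ae_of_ae_map measurable_snd.aemeasurable hustarae] with p hp1 hp2
  have hle : ((⟪p.1, p.2⟫ : ℝ) : EReal) - u p.1 ≤ legendre u p.2 :=
    le_iSup (fun x => ((⟪x, p.2⟫ : ℝ) : EReal) - u x) p.1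
  rw [← EReal.coe_toReal hp1 (hubot _), ← EReal.coe_sub] at hle
  have hbot : legendre u p.2 ≠ ⊥ := fun h => by
    rw [h] at hle
    exact EReal.coe_ne_bot _ (le_bot_iff.1 hle)
  rw [← EReal.coe_toReal hp2 hbot, EReal.coe_le_coe_iff] at hle
  linarith

theorem comp_piecewise_eq {α β γ : Type*} (A : Set α) [∀ x, Decidable (x ∈ A)]
    (F : α → β → γ) (a b : α → β) :
    (fun x => F x (A.piecewise a b x)) =
      A.piecewise (fun x => F x (a x)) (fun x => F x (b x)) := by
  ext x
  by_cases hx : x ∈ A <;> simp [hx]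

theorem integrable_piecewise_of_bounded {α : Type*} [MeasurableSpace α] {ν : Measure α}
    {A : Set α} [∀ x, Decidable (x ∈ A)] (hA : MeasurableSet A) (hAfin : ν A ≠ ⊤)
    {a b : α → ℝ} (ha : Measurable a) {C : ℝ} (hC : ∀ x ∈ A, |a x| ≤ C) (hb : Integrable b ν) :
    Integrable (A.piecewise a b) ν :=
  Integrable.piecewise hA
    (Measure.integrableOn_of_bounded hAfin ha.aestronglyMeasurable
      ((ae_restrict_iff' hA).2 (Eventually.of_forall hC))) hb.integrableOn

/-- `g` is the density of a probability measure with finite first moment, carried by `S`, for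
which both the entropy and the integral of `v` are finite. -/
structure IsAdmissibleDensity {d : ℕ} (S : Set (Ed d)) (v g : Ed d → ℝ) : Prop where
  measurable : Measurable g
  nonneg : ∀ x, 0 ≤ g x
  integrable : Integrable g
  integral_eq_one : ∫ x, g x = 1
  integrable_mul_norm : Integrable fun x => g x * ‖x‖
  integrable_mul_log : Integrable fun x => g x * log (g x)
  integrable_mul : Integrable fun x => g x * v x
  ae_mem : ∀ᵐ x, g x ≠ 0 → x ∈ S

/-- Modifying a density on a bounded set where `v` is bounded, by a Gibbs density. -/
theorem isAdmissibleDensity_piecewise {d : ℕ} {S A : Set (Ed d)} [∀ x, Decidable (x ∈ A)]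
    {v f : Ed d → ℝ} (hA : MeasurableSet A) (hAS : A ⊆ S) {R : ℝ} (hAR : ∀ x ∈ A, ‖x‖ ≤ R)
    (hAv : ∀ x ∈ A, |v x| ≤ R) (hv : Measurable v) {c : ℝ} (hc : 0 < c)
    (hf : Measurable f) (hf0 : ∀ x, 0 ≤ f x) (hfi : Integrable f)
    (hf1 : Integrable fun x => f x * ‖x‖) (hflog : Integrable fun x => f x * log (f x))
    (hfv : Integrable fun x => f x * v x) (hfS : ∀ᵐ x, f x ≠ 0 → x ∈ S)
    (hone : ∫ x, A.piecewise (fun x => c * exp (-v x)) f x = 1) :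
    IsAdmissibleDensity S v (A.piecewise (fun x => c * exp (-v x)) f) := by
  have hAfin : volume A ≠ ⊤ :=
    ((Metric.isBounded_closedBall (x := (0 : Ed d)) (r := R)).subset fun x hx => by
      simpa using hAR x hx).measure_lt_top.ne
  have hbd : ∀ x ∈ A, |c * exp (-v x)| ≤ c * exp R := fun x hx => by
    rw [abs_of_pos (by positivity)]
    gcongr
    linarith [(abs_le.1 (hAv x hx)).1]
  have hgm : Measurable fun x => c * exp (-v x) := by fun_prop
  refine ⟨hgm.piecewise hA hf, fun x => ?_, ?_, hone, ?_, ?_, ?_, ?_⟩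
  · by_cases hx : x ∈ A
    · simp [hx]; positivity
    · simp [hx, hf0 x]
  · exact integrable_piecewise_of_bounded hA hAfin hgm hbd hfi
  · rw [comp_piecewise_eq A (fun x t => t * ‖x‖)]
    refine integrable_piecewise_of_bounded hA hAfin (C := c * exp R * R) (by fun_prop) ?_ hf1
    intro x hx
    rw [abs_mul, abs_norm]
    exact mul_le_mul (hbd x hx) (hAR x hx) (norm_nonneg _) (by positivity)
  · rw [comp_piecewise_eq A (fun _ t => t * log t)]
    refine integrable_piecewise_of_bounded hA hAfin (C := c * exp R * (|log c| + R))
      (by fun_prop) ?_ hflog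
    intro x hx
    rw [abs_mul, log_mul hc.ne' (exp_pos _).ne', log_exp]
    refine mul_le_mul (hbd x hx) ?_ (abs_nonneg _) (by positivity)
    refine (abs_add_le _ _).trans ?_
    rw [abs_neg]
    gcongr
    exact hAv x hx
  · rw [comp_piecewise_eq A (fun x t => t * v x)]
    refine integrable_piecewise_of_bounded hA hAfin (C := c * exp R * R) (by fun_prop) ?_ hfv
    intro x hx
    rw [abs_mul]
    exact mul_le_mul (hbd x hx) (hAv x hx) (abs_nonneg _) (by positivity)
  · filter_upwards [hfS] with x hx hgx
    by_cases hxA : x ∈ A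
    · exact hAS hxA
    · exact hx (by simpa [hxA] using hgx)

theorem setIntegral_exp_neg_pos {d : ℕ} {A : Set (Ed d)} {v : Ed d → ℝ} (hA : MeasurableSet A)
    (hA0 : volume A ≠ 0) {R : ℝ} (hAR : ∀ x ∈ A, ‖x‖ ≤ R) (hAv : ∀ x ∈ A, |v x| ≤ R)
    (hv : Measurable v) : 0 < ∫ x in A, exp (-v x) := by
  have hAfin : volume A ≠ ⊤ :=
    ((Metric.isBounded_closedBall (x := (0 : Ed d)) (r := R)).subset fun x hx => by
      simpa using hAR x hx).measure_lt_top.ne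
  have hint : IntegrableOn (fun x => exp (-v x)) A := by
    refine Measure.integrableOn_of_bounded (M := exp R) hAfin
      (by fun_prop : Measurable fun x => exp (-v x)).aestronglyMeasurable
      ((ae_restrict_iff' hA).2 (Eventually.of_forall fun x hx => ?_))
    rw [Real.norm_eq_abs, abs_of_pos (exp_pos _)]
    gcongr
    linarith [(abs_le.1 (hAv x hx)).1]
  rw [setIntegral_pos_iff_support_of_nonneg_ae
    (Eventually.of_forall fun x => (exp_pos _).le) hint]
  have : Function.support (fun x => exp (-v x)) = Set.univ := by
    ext x; simp [(exp_pos _).ne']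
  rw [this, Set.univ_inter]
  exact pos_iff_ne_zero.2 hA0

theorem integral_piecewise_eq {d : ℕ} {A : Set (Ed d)} [∀ x, Decidable (x ∈ A)]
    {v f : Ed d → ℝ} (hA : MeasurableSet A) (hA0 : volume A ≠ 0) {R : ℝ}
    (hAR : ∀ x ∈ A, ‖x‖ ≤ R) (hAv : ∀ x ∈ A, |v x| ≤ R) (hv : Measurable v)
    (hfi : Integrable f) (m : ℝ) :
    ∫ x, A.piecewise (fun x => m / (∫ x in A, exp (-v x)) * exp (-v x)) f x =
      m + ∫ x in Aᶜ, f x := by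
  have hZ := setIntegral_exp_neg_pos hA hA0 hAR hAv hv
  have hint : IntegrableOn (fun x => exp (-v x)) A := by
    by_contra h
    exact hZ.ne' (integral_undef h)
  rw [integral_piecewise hA (hint.const_mul _) hfi.integrableOn, integral_const_mul,
    div_mul_cancel₀ _ hZ.ne']

/-- A minimizer of `∫ g log g + ∫ g v` is proportional to `exp (-v)` on every bounded set of
positive mass where `v` is bounded. -/
theorem exists_ae_eq_exp_neg_of_isMinimizer {d : ℕ} {S A : Set (Ed d)} {v f : Ed d → ℝ}
    (hv : Measurable v) (hf : IsAdmissibleDensity S v f)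
    (hmin : ∀ g, IsAdmissibleDensity S v g →
      (∫ x, f x * log (f x)) + ∫ x, f x * v x ≤ (∫ x, g x * log (g x)) + ∫ x, g x * v x)
    (hA : MeasurableSet A) (hAS : A ⊆ S) {R : ℝ} (hAR : ∀ x ∈ A, ‖x‖ ≤ R)
    (hAv : ∀ x ∈ A, |v x| ≤ R) (hA0 : volume A ≠ 0) (hm : 0 < ∫ x in A, f x) :
    ∃ c : ℝ, 0 < c ∧ ∀ᵐ x, x ∈ A → f x = c * exp (-v x) := by
  classical
  set m := ∫ x in A, f x
  set c := m / ∫ x in A, exp (-v x) with hc_def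
  have hc : 0 < c := div_pos hm (setIntegral_exp_neg_pos hA hA0 hAR hAv hv)
  set g := A.piecewise (fun x => c * exp (-v x)) f with hg_def
  have hg1 : ∫ x, g x = 1 := by
    rw [hg_def, hc_def, integral_piecewise_eq hA hA0 hAR hAv hv hf.integrable,
      integral_add_compl hA hf.integrable, hf.integral_eq_one]
  have hg : IsAdmissibleDensity S v g :=
    isAdmissibleDensity_piecewise hA hAS hAR hAv hv hc hf.measurable hf.nonneg hf.integrable
      hf.integrable_mul_norm hf.integrable_mul_log hf.integrable_mul hf.ae_mem hg1
  have hle := hmin g hg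
  set D : Ed d → ℝ := fun x => ((f x * log (f x) + f x * v x) - (g x * log (g x) + g x * v x))
    + (log c + 1) * (g x - f x) with hD
  have i1 : Integrable fun x => f x * log (f x) + f x * v x :=
    hf.integrable_mul_log.add hf.integrable_mul
  have i2 : Integrable fun x => g x * log (g x) + g x * v x :=
    hg.integrable_mul_log.add hg.integrable_mul
  have i3 : Integrable fun x => (log c + 1) * (g x - f x) :=
    (hg.integrable.sub hf.integrable).const_mul (log c + 1)
  have hDint : Integrable D := (i1.sub i2).add i3
  have hDeq : ∀ x ∈ A, D x = f x * log (f x) - f x * log (c * exp (-v x)) - f x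
      + c * exp (-v x) := fun x hx => by
    simp only [hD, hg_def, hx, Set.piecewise_eq_of_mem, log_mul hc.ne' (exp_pos _).ne', log_exp]
    ring
  have hD0 : 0 ≤ D := fun x => by
    by_cases hx : x ∈ A
    · rw [hDeq x hx]
      exact relEntropy_integrand_nonneg (hf.nonneg x) (mul_pos hc (exp_pos _))
    · simp [hD, hg_def, hx]
  have hDval : ∫ x, D x ≤ 0 := by
    have e : ∫ x, D x = ((∫ x, f x * log (f x)) + ∫ x, f x * v x)
        - ((∫ x, g x * log (g x)) + ∫ x, g x * v x)
        + (log c + 1) * ((∫ x, g x) - ∫ x, f x) := by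
      rw [← integral_add hf.integrable_mul_log hf.integrable_mul,
        ← integral_add hg.integrable_mul_log hg.integrable_mul,
        ← integral_sub hg.integrable hf.integrable, ← integral_const_mul,
        ← integral_sub i1 i2]
      exact integral_add (i1.sub i2) i3
    rw [e, hg1, hf.integral_eq_one]
    linarith
  have hDae := (integral_eq_zero_iff_of_nonneg hD0 hDint).1
    (le_antisymm hDval (integral_nonneg hD0))
  refine ⟨c, hc, ?_⟩
  filter_upwards [hDae] with x hx hxA
  rw [hDeq x hxA] at hx
  exact eq_of_relEntropy_integrand_eq_zero (hf.nonneg x) (mul_pos hc (exp_pos _)) hx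

/-- a minimizer of `E(·) + T(·,μ)` whose optimal potential is `u` has density
proportional to `e^{-u}`. -/
theorem minimizer_density_eq_exp_neg {d : ℕ} (hd : 1 ≤ d)
    (μ : Measure (Ed d)) [IsProbabilityMeasure μ] (hμ1 : FirstMoment μ) (hμc : Centered μ)
    (hμH : ¬ ∃ e : Ed d, ∃ ℓ : ℝ, ‖e‖ = 1 ∧ μ {y | (⟪y, e⟫ : ℝ) = ℓ} = 1)
    (ρ' : Measure (Ed d)) [IsProbabilityMeasure ρ'] (hρ'1 : FirstMoment ρ')
    (hmin : ∀ ρ : Measure (Ed d), IsProbabilityMeasure ρ → FirstMoment ρ →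
      entropy ρ' + maxCorr ρ' μ ≤ entropy ρ + maxCorr ρ μ)
    (u : Ed d → EReal) (hubot : ∀ x, u x ≠ ⊥) (huconv : EConvexOn u)
    (hulsc : LowerSemicontinuous u) (huproper : ∃ x, u x ≠ ⊤)
    -- `∫ u dρ'` is finite:
    (huae : ∀ᵐ x ∂ρ', u x ≠ ⊤) (huint : Integrable (fun x => (u x).toReal) ρ')
    -- `∫ u* dμ` is finite:
    (hustarae : ∀ᵐ y ∂μ, legendre u y ≠ ⊤)
    (hustarint : Integrable (fun y => (legendre u y).toReal) μ)
    -- `u` realizes `T(ρ',μ) = ∫ u dρ' + ∫ u* dμ`: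
    (heq : maxCorr ρ' μ =
      (((∫ x, (u x).toReal ∂ρ') + ∫ y, (legendre u y).toReal ∂μ : ℝ) : EReal))
    -- `ρ'` is absolutely continuous with density `f`, and `u = +∞` a.e. on `{f = 0}`:
    (f : Ed d → ℝ) (hfmeas : Measurable f) (hf0 : ∀ x, 0 ≤ f x)
    (hρ'f : ρ' = volume.withDensity (fun x => ENNReal.ofReal (f x)))
    (hvanish : ∀ᵐ x ∂(volume : Measure (Ed d)), f x = 0 → u x = ⊤) :
    ∃ c : ℝ, 0 < c ∧ ∀ᵐ x ∂(volume : Measure (Ed d)), f x = c * expNegE (u x) := by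
  classical
  set v : Ed d → ℝ := fun x => (u x).toReal with hv_def
  set S : Set (Ed d) := {x | u x ≠ ⊤} with hS_def
  set K : ℝ := ∫ y, (legendre u y).toReal ∂μ
  have hum : Measurable u := hulsc.measurable
  have hv : Measurable v := hum.ereal_toReal
  have hSm : MeasurableSet S := (hum (measurableSet_singleton ⊤)).compl
  have hfi : Integrable f := by
    have := (integrable_withDensity_ofReal_iff hfmeas hf0 (h := fun _ => (1 : ℝ))).1
      (by rw [← hρ'f]; exact integrable_const 1)
    simpa using this
  have hfone : ∫ x, f x = 1 := by
    have := integral_withDensity_ofReal (ν := volume) hfmeas hf0 (fun _ => (1 : ℝ))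
    rw [← hρ'f] at this
    simpa using this.symm
  have hf1 : Integrable fun x => f x * ‖x‖ :=
    (integrable_withDensity_ofReal_iff hfmeas hf0).1 (hρ'f ▸ hρ'1)
  have hfv : Integrable fun x => f x * v x :=
    (integrable_withDensity_ofReal_iff hfmeas hf0).1 (hρ'f ▸ huint)
  have hfS : ∀ᵐ x, f x ≠ 0 → x ∈ S := by
    have h := huae
    rw [hρ'f, ae_withDensity_iff hfmeas.ennreal_ofReal] at h
    filter_upwards [h] with x hx hfx
    exact hx (by simpa using lt_of_le_of_ne (hf0 x) (Ne.symm hfx))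
  have hfv_eq : ∫ x, v x ∂ρ' = ∫ x, f x * v x := by
    rw [hρ'f]; exact integral_withDensity_ofReal hfmeas hf0 v
  have hcomp : ∀ g, IsAdmissibleDensity S v g →
      entropy ρ' + (((∫ x, f x * v x) + K : ℝ) : EReal) ≤
        (((∫ x, g x * log (g x)) + ((∫ x, g x * v x) + K) : ℝ) : EReal) := by
    intro g hg
    set ρ : Measure (Ed d) := volume.withDensity fun x => ENNReal.ofReal (g x) with hρ
    have hle := hmin ρ
      (isProbabilityMeasure_withDensity_ofReal hg.nonneg hg.integrable hg.integral_eq_one)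
      ((integrable_withDensity_ofReal_iff hg.measurable hg.nonneg).2 hg.integrable_mul_norm)
    have hgS : ∀ᵐ x ∂ρ, u x ≠ ⊤ := by
      rw [hρ, ae_withDensity_iff hg.measurable.ennreal_ofReal]
      filter_upwards [hg.ae_mem] with x hx hgx
      exact hx fun h => hgx (by simp [h])
    have hT := maxCorr_le_integral_add_integral_legendre (ρ := ρ) (μ := μ) hubot hgS
      ((integrable_withDensity_ofReal_iff hg.measurable hg.nonneg).2 hg.integrable_mul)
      hustarae hustarint
    rw [integral_withDensity_ofReal hg.measurable hg.nonneg] at hT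
    rw [heq, hfv_eq] at hle
    refine hle.trans ?_
    rw [entropy_withDensity_ofReal hg.measurable hg.nonneg,
      posPart_sub_negPart_eq_integral hg.integrable_mul_log, EReal.coe_add (∫ x, g x * log (g x))]
    gcongr
  let A : ℕ → Set (Ed d) := fun n => {x | x ∈ S ∧ ‖x‖ ≤ n ∧ |v x| ≤ n}
  have hAm : ∀ n, MeasurableSet (A n) := fun n =>
    hSm.inter ((measurableSet_le measurable_norm measurable_const).inter
      (measurableSet_le hv.abs measurable_const))
  have hAS : ∀ n, A n ⊆ S := fun n x hx => hx.1
  have hAR : ∀ n, ∀ x ∈ A n, ‖x‖ ≤ n := fun n x hx => hx.2.1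
  have hAv : ∀ n, ∀ x ∈ A n, |v x| ≤ n := fun n x hx => hx.2.2
  have hAmono : ∀ {m n : ℕ}, m ≤ n → A m ⊆ A n := fun {m n} hmn x hx => by
    have h : (m : ℝ) ≤ n := by exact_mod_cast hmn
    exact ⟨hx.1, hx.2.1.trans h, hx.2.2.trans h⟩
  have hAex : ∀ N : ℕ, ∀ x ∈ S, ∃ n, N ≤ n ∧ x ∈ A n := fun N x hx => by
    obtain ⟨n, hn⟩ := exists_nat_ge (max ‖x‖ |v x|)
    have h : (n : ℝ) ≤ (max N n : ℕ) := by exact_mod_cast le_max_right N n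
    exact ⟨max N n, le_max_left _ _, hx, (le_max_left _ _).trans (hn.trans h),
      (le_max_right _ _).trans (hn.trans h)⟩
  obtain ⟨N, hN⟩ : ∃ N, ρ' (A N) ≠ 0 := by
    by_contra! h
    have h0 : ∀ᵐ x ∂ρ', ∀ n, x ∉ A n := ae_all_iff.2 fun n => measure_eq_zero_iff_ae_notMem.1 (h n)
    obtain ⟨x, hx, hxS⟩ := (h0.and huae).exists
    obtain ⟨n, -, hn⟩ := hAex 0 x hxS
    exact hx n hn
  have hρ'ac : ρ' ≪ volume := hρ'f ▸ withDensity_absolutelyContinuous _ _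
  have hpos : ∀ n, N ≤ n → volume (A n) ≠ 0 ∧ 0 < ∫ x in A n, f x := by
    intro n hn
    have hρn : ρ' (A n) ≠ 0 := fun h => hN (measure_mono_null (hAmono hn) h)
    refine ⟨fun h => hρn (hρ'ac h), ?_⟩
    rw [hρ'f, withDensity_apply _ (hAm n), ← ofReal_integral_eq_lintegral_ofReal hfi.integrableOn
      (Eventually.of_forall hf0)] at hρn
    simpa using hρn
  have hent : entropy ρ' ≠ ⊤ := by
    have hvol := (hpos N le_rfl).1
    have hg := isAdmissibleDensity_piecewise (f := fun _ => 0) (hAm N) (hAS N) (hAR N) (hAv N) hv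
      (one_div_pos.2 (setIntegral_exp_neg_pos (hAm N) hvol (hAR N) (hAv N) hv))
      measurable_const (fun _ => le_rfl) (integrable_zero _ _ _) (by simp) (by simp) (by simp)
      (by simp)
      ((integral_piecewise_eq (hAm N) hvol (hAR N) (hAv N) hv (integrable_zero _ _ _) 1).trans
        (by simp))
    intro htop
    have := hcomp _ hg
    rw [htop, EReal.top_add_coe] at this
    exact EReal.coe_ne_top _ (top_le_iff.1 this)
  have hflog : Integrable fun x => f x * log (f x) :=
    integrable_mul_log_of_entropy_ne_top hfmeas hf0 hfi hf1 (hρ'f ▸ hent)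
  have hentf : entropy ρ' = ((∫ x, f x * log (f x) : ℝ) : EReal) := by
    rw [hρ'f, entropy_withDensity_ofReal hfmeas hf0, posPart_sub_negPart_eq_integral hflog]
  have hf : IsAdmissibleDensity S v f := ⟨hfmeas, hf0, hfi, hfone, hf1, hflog, hfv, hfS⟩
  have hloc : ∀ n, N ≤ n → ∃ c : ℝ, 0 < c ∧ ∀ᵐ x, x ∈ A n → f x = c * exp (-v x) := by
    intro n hn
    refine exists_ae_eq_exp_neg_of_isMinimizer hv hf (fun g hg => ?_) (hAm n) (hAS n) (hAR n)
      (hAv n) (hpos n hn).1 (hpos n hn).2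
    have h := hcomp g hg
    rw [hentf, ← EReal.coe_add, EReal.coe_le_coe_iff] at h
    linarith
  obtain ⟨c, hc, hcN⟩ := hloc N le_rfl
  have hglob : ∀ n, N ≤ n → ∀ᵐ x, x ∈ A n → f x = c * exp (-v x) := by
    intro n hn
    obtain ⟨c', -, hc'⟩ := hloc n hn
    have hfreq : ∃ᵐ x ∂(volume : Measure (Ed d)), x ∈ A N :=
      frequently_ae_mem_iff.2 (hpos N le_rfl).1
    obtain ⟨x, hxN, h1, h2⟩ := (hfreq.and_eventually (hcN.and hc')).exists
    have h := (h1 hxN).symm.trans (h2 (hAmono hn hxN))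
    rwa [mul_right_cancel₀ (exp_pos _).ne' h]
  refine ⟨c, hc, ?_⟩
  filter_upwards [ae_all_iff.2 fun n => ae_all_iff.2 fun hn : N ≤ n => hglob n hn, hfS]
    with x hx hxS
  by_cases hxu : u x = ⊤
  · have hfx : f x = 0 := by
      by_contra h
      exact hxS h hxu
    simp [expNegE, hxu, hfx]
  · obtain ⟨n, hn, hxn⟩ := hAex N x hxu
    rw [hx n hn hxn, expNegE, if_neg hxu]
end
end

section
/- Let d ≥ 1 and let μ ∈ P_1(ℝ^d) be centered and not supported on an affine hyperplane. If ρ_0 and ρ_1 both minimize E(·) + T(·,μ) over P_1(ℝ^d), then there exists a vector w ∈ ℝ^d such that ρ_1 is the pushforward of ρ_0 under the translation x ↦ x + w. -/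
open MeasureTheory Real Filter Topology
open scoped ENNReal RealInnerProductSpace

noncomputable section

namespace EntropyTransport

open Set ProbabilityTheory

lemma lintegral_withDensity_mul {α : Type*} [MeasurableSpace α] (μ : Measure α) {f φ : α → ℝ≥0∞}
    (hf : Measurable f) (hφ : Measurable φ) :
    ∫⁻ x, φ x ∂(μ.withDensity f) = ∫⁻ x, f x * φ x ∂μ :=
  lintegral_withDensity_eq_lintegral_mul μ hf hφ

/-! ### Quantile functions -/

/-- The uniform probability measure on `(0, 1)`. -/
def unif : Measure ℝ := volume.restrict (Ioo 0 1)

instance : IsProbabilityMeasure unif := ⟨by simp [unif]⟩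

open Classical in
/-- The quantile function of a probability measure on `ℝ`, extended by `0` outside `(0, 1)`. -/
def quantile (ν : Measure ℝ) (u : ℝ) : ℝ :=
  if u ∈ Ioo (0 : ℝ) 1 then sInf {x | u ≤ cdf ν x} else 0

lemma quantile_le_iff (ν : Measure ℝ) {u : ℝ} (hu : u ∈ Ioo (0 : ℝ) 1) (x : ℝ) :
    quantile ν u ≤ x ↔ u ≤ cdf ν x := by
  rw [quantile, if_pos hu]
  have hbdd : BddBelow {x | u ≤ cdf ν x} := by
    obtain ⟨a, ha⟩ := ((tendsto_cdf_atBot ν).eventually (gt_mem_nhds hu.1)).exists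
    exact ⟨a, fun y hy => le_of_not_gt fun h =>
      absurd (hy.trans (monotone_cdf ν h.le)) (not_le.mpr ha)⟩
  have hne : {x | u ≤ cdf ν x}.Nonempty := by
    obtain ⟨a, ha⟩ := ((tendsto_cdf_atTop ν).eventually (lt_mem_nhds hu.2)).exists
    exact ⟨a, ha.le⟩
  refine ⟨fun h => ?_, fun h => csInf_le hbdd h⟩
  have hright := ((cdf ν).right_continuous x).tendsto.mono_left
    (nhdsWithin_mono x Ioi_subset_Ici_self)
  refine ge_of_tendsto hright ?_
  filter_upwards [self_mem_nhdsWithin] with y hy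
  obtain ⟨z, hz, hzy⟩ := exists_lt_of_csInf_lt hne (lt_of_le_of_lt h hy)
  exact hz.trans (monotone_cdf ν hzy.le)

lemma quantile_mono (ν : Measure ℝ) : MonotoneOn (quantile ν) (Ioo 0 1) := fun _ hu _ hv huv =>
  (quantile_le_iff ν hu _).2 (huv.trans ((quantile_le_iff ν hv _).1 le_rfl))

lemma measurable_quantile {Ω : Type} [MeasurableSpace Ω] (κ : Ω → Measure ℝ)
    [∀ ω, IsProbabilityMeasure (κ ω)] (hκ : ∀ x, Measurable fun ω => κ ω (Iic x)) :
    Measurable fun p : Ω × ℝ => quantile (κ p.1) p.2 := by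
  refine measurable_of_Iic fun x => ?_
  have hc : Measurable fun ω => cdf (κ ω) x := by
    simp_rw [cdf_eq_real, Measure.real]
    exact (hκ x).ennreal_toReal
  have : (fun p : Ω × ℝ => quantile (κ p.1) p.2) ⁻¹' Iic x =
      ({p | p.2 ∈ Ioo (0 : ℝ) 1} ∩ {p | p.2 ≤ cdf (κ p.1) x}) ∪
      ({p | p.2 ∈ Ioo (0 : ℝ) 1}ᶜ ∩ {_p | (0 : ℝ) ≤ x}) := by
    ext p
    by_cases hp : p.2 ∈ Ioo (0 : ℝ) 1
    · have := quantile_le_iff (κ p.1) hp x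
      simp only [mem_preimage, mem_Iic, this, mem_union, mem_inter_iff, mem_ofPred_eq, hp,
        mem_compl_iff, true_and, not_true, false_and, or_false]
    · have hq : quantile (κ p.1) p.2 = 0 := if_neg hp
      simp only [mem_preimage, mem_Iic, hq, mem_union, mem_inter_iff,
        mem_ofPred_eq, hp, mem_compl_iff, not_false_eq_true, true_and, false_and, false_or]
  rw [this]
  have h1 : MeasurableSet {p : Ω × ℝ | p.2 ∈ Ioo (0 : ℝ) 1} := measurable_snd measurableSet_Ioo
  exact (h1.inter (measurableSet_le measurable_snd (hc.comp measurable_fst))).union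
    (h1.compl.inter (MeasurableSet.const _))

lemma measurable_quantile_single (ν : Measure ℝ) [IsProbabilityMeasure ν] :
    Measurable (quantile ν) :=
  (measurable_quantile (fun _ : Unit => ν) fun _ => measurable_const).comp
    (measurable_const.prodMk measurable_id : Measurable fun u : ℝ => ((), u))

lemma map_quantile (ν : Measure ℝ) [IsProbabilityMeasure ν] : unif.map (quantile ν) = ν := by
  have hm := measurable_quantile_single ν
  have : IsProbabilityMeasure (unif.map (quantile ν)) :=
    Measure.isProbabilityMeasure_map hm.aemeasurable
  refine Measure.ext_of_Iic _ _ fun x => ?_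
  rw [Measure.map_apply hm measurableSet_Iic, unif,
    Measure.restrict_apply (hm measurableSet_Iic), ← ofReal_cdf]
  have : quantile ν ⁻¹' Iic x ∩ Ioo 0 1 = Iic (cdf ν x) ∩ Ioo 0 1 := by
    ext u
    simp only [mem_inter_iff, mem_preimage, mem_Iic]
    exact and_congr_left fun hu => quantile_le_iff ν hu x
  rw [this]
  have h1 := cdf_le_one ν x
  have h0 := cdf_nonneg ν x
  apply le_antisymm
  · calc volume (Iic (cdf ν x) ∩ Ioo 0 1) ≤ volume (Ioc 0 (cdf ν x)) :=
        measure_mono fun _ hu => ⟨hu.2.1, hu.1⟩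
      _ = _ := by simp
  · calc ENNReal.ofReal (cdf ν x) = volume (Ioo 0 (cdf ν x)) := by simp
      _ ≤ volume (Iic (cdf ν x) ∩ Ioo 0 1) :=
        measure_mono fun _ hu => ⟨hu.2.le, hu.1, hu.2.trans_le h1⟩

lemma ae_unif_mem : ∀ᵐ u ∂unif, u ∈ Ioo (0 : ℝ) 1 :=
  ae_restrict_mem measurableSet_Ioo

/-- A measure on `ℝ` that gives each interval at most its length is at most Lebesgue measure. -/
lemma le_volume_of_Ioc (ν : Measure ℝ) (h : ∀ a b, ν (Ioc a b) ≤ ENNReal.ofReal (b - a)) :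
    ν ≤ volume := by
  have : ν.toOuterMeasure ≤ StieltjesFunction.id.outer := by
    refine OuterMeasure.le_ofFunction.2 fun s => ?_
    rw [StieltjesFunction.length_eq]
    refine le_iInf fun a => le_iInf fun b => le_iInf fun hs => ?_
    have hs' : s ⊆ Ioc a b := fun x hx => hs ⟨hx, notMem_botSet_of_lt (sub_one_lt x)⟩
    simpa using (measure_mono hs').trans (h a b)
  refine Measure.le_iff.2 fun s hs => ?_
  rw [Real.volume_eq_stieltjes_id, StieltjesFunction.measure]
  exact this s

/-- For a density `f` of `ν`, the reciprocal of `f` along the quantile function. -/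
lemma setLIntegral_inv_density_le {f : ℝ → ℝ≥0∞} (hf : Measurable f) {S : ℝ → ℝ}
    (hS : Measurable S) (hlaw : unif.map S = volume.withDensity f) (K : Set ℝ) (p q : ℝ)
    (hK : ∀ u ∈ K, S u ∈ Icc p q) (hKm : MeasurableSet K) :
    ∫⁻ u in K, (f (S u))⁻¹ ∂unif ≤ ENNReal.ofReal (q - p) := by
  calc ∫⁻ u in K, (f (S u))⁻¹ ∂unif
      = ∫⁻ u, K.indicator (fun u => (f (S u))⁻¹) u ∂unif := (lintegral_indicator hKm _).symm
    _ ≤ ∫⁻ u, (Icc p q).indicator (fun x => (f x)⁻¹) (S u) ∂unif := by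
        refine lintegral_mono fun u => ?_
        by_cases hu : u ∈ K
        · simp [hu, hK u hu]
        · simp [hu]
    _ = ∫⁻ x, (Icc p q).indicator (fun x => (f x)⁻¹) x ∂(unif.map S) :=
        (lintegral_map (hf.inv.indicator measurableSet_Icc) hS).symm
    _ = ∫⁻ x, f x * (Icc p q).indicator (fun x => (f x)⁻¹) x := by
        rw [hlaw]
        exact lintegral_withDensity_mul _ hf (hf.inv.indicator measurableSet_Icc)
    _ ≤ ∫⁻ x, (Icc p q).indicator 1 x := by
        refine lintegral_mono fun x => ?_
        by_cases hx : x ∈ Icc p q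
        · simp [hx, ENNReal.mul_inv_le_one (f x)]
        · simp [hx]
    _ = _ := by rw [lintegral_indicator_one measurableSet_Icc, Real.volume_Icc]

lemma le_setLIntegral_inv_density {f : ℝ → ℝ≥0∞} (hf : Measurable f) {S : ℝ → ℝ}
    (hS : Measurable S) (hlaw : unif.map S = volume.withDensity f) (K : Set ℝ) (p q : ℝ)
    (hK : ∀ᵐ u ∂unif, S u ∈ Ioo p q → u ∈ K) (hKm : MeasurableSet K)
    (hpos : ∀ᵐ x ∂(volume.restrict (Ioo p q)), f x ≠ 0) (hfin : ∀ᵐ x, f x ≠ ∞) :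
    ENNReal.ofReal (q - p) ≤ ∫⁻ u in K, (f (S u))⁻¹ ∂unif := by
  calc ENNReal.ofReal (q - p)
      = ∫⁻ x, (Ioo p q).indicator 1 x := by
        rw [lintegral_indicator_one measurableSet_Ioo, Real.volume_Ioo]
    _ ≤ ∫⁻ x, f x * (Ioo p q).indicator (fun x => (f x)⁻¹) x := by
        refine lintegral_mono_ae ?_
        filter_upwards [hfin, (ae_restrict_iff' measurableSet_Ioo).1 hpos] with x h1 h2
        by_cases hx : x ∈ Ioo p q
        · simp [hx, ENNReal.mul_inv_cancel (h2 hx) h1]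
        · simp [hx]
    _ = ∫⁻ x, (Ioo p q).indicator (fun x => (f x)⁻¹) x ∂(unif.map S) := by
        rw [hlaw]
        exact (lintegral_withDensity_mul _ hf (hf.inv.indicator measurableSet_Ioo)).symm
    _ = ∫⁻ u, (Ioo p q).indicator (fun x => (f x)⁻¹) (S u) ∂unif :=
        lintegral_map (hf.inv.indicator measurableSet_Ioo) hS
    _ ≤ ∫⁻ u, K.indicator (fun u => (f (S u))⁻¹) u ∂unif := by
        refine lintegral_mono_ae ?_
        filter_upwards [hK] with u hu
        by_cases h : S u ∈ Ioo p q
        · simp [hu h, h]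
        · simp [h]
    _ = ∫⁻ u in K, (f (S u))⁻¹ ∂unif := lintegral_indicator hKm _

/-- The ranges of two increasing functions over a set on which their average varies by at most
`b - a` have total width at most `2 (b - a)`. -/
lemma exists_Icc_of_midpoint {S T : ℝ → ℝ} {K : Set ℝ} (hS : MonotoneOn S K)
    (hT : MonotoneOn T K) {a b : ℝ} (hab : a ≤ b)
    (hM : ∀ u ∈ K, (1 / 2 : ℝ) • S u + (1 / 2 : ℝ) • T u ∈ Icc a b) :
    ∃ p q p' q' : ℝ, p ≤ q ∧ p' ≤ q' ∧ (∀ u ∈ K, S u ∈ Icc p q) ∧ (∀ u ∈ K, T u ∈ Icc p' q') ∧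
      (q - p) + (q' - p') ≤ 2 * (b - a) := by
  rcases K.eq_empty_or_nonempty with rfl | hne
  · exact ⟨0, 0, 0, 0, le_rfl, le_rfl, by simp, by simp, by linarith⟩
  have key : ∀ u ∈ K, ∀ v ∈ K, ∀ u' ∈ K, ∀ v' ∈ K,
      (S u - S v) + (T u' - T v') ≤ 2 * (b - a) := by
    intro u hu v hv u' hu' v' hv'
    have hmax : max u u' ∈ K := by rcases max_choice u u' with h | h <;> rw [h] <;> assumption
    have hmin : min v v' ∈ K := by rcases min_choice v v' with h | h <;> rw [h] <;> assumption
    have h1 := hS hu hmax (le_max_left _ _)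
    have h2 := hT hu' hmax (le_max_right _ _)
    have h3 := hS hmin hv (min_le_left _ _)
    have h4 := hT hmin hv' (min_le_right _ _)
    have h5 := (hM _ hmax).2
    have h6 := (hM _ hmin).1
    simp only [smul_eq_mul] at h5 h6
    linarith
  obtain ⟨w, hw⟩ := hne
  have hSa : BddAbove (S '' K) := ⟨S w + 2 * (b - a), by
    rintro _ ⟨u, hu, rfl⟩; linarith [key u hu w hw w hw w hw]⟩
  have hSb : BddBelow (S '' K) := ⟨S w - 2 * (b - a), by
    rintro _ ⟨u, hu, rfl⟩; linarith [key w hw u hu w hw w hw]⟩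
  have hTa : BddAbove (T '' K) := ⟨T w + 2 * (b - a), by
    rintro _ ⟨u, hu, rfl⟩; linarith [key w hw w hw u hu w hw]⟩
  have hTb : BddBelow (T '' K) := ⟨T w - 2 * (b - a), by
    rintro _ ⟨u, hu, rfl⟩; linarith [key w hw w hw w hw u hu]⟩
  have hSn : (S '' K).Nonempty := ⟨_, w, hw, rfl⟩
  have hTn : (T '' K).Nonempty := ⟨_, w, hw, rfl⟩
  refine ⟨sInf (S '' K), sSup (S '' K), sInf (T '' K), sSup (T '' K), csInf_le_csSup hSn hSb hSa,
    csInf_le_csSup hTn hTb hTa,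
    fun u hu => ⟨csInf_le hSb ⟨u, hu, rfl⟩, le_csSup hSa ⟨u, hu, rfl⟩⟩,
    fun u hu => ⟨csInf_le hTb ⟨u, hu, rfl⟩, le_csSup hTa ⟨u, hu, rfl⟩⟩, ?_⟩
  have h1 : ∀ u ∈ K, ∀ v ∈ K, ∀ u' ∈ K,
      S u - S v + T u' - 2 * (b - a) ≤ sInf (T '' K) := fun u hu v hv u' hu' =>
    le_csInf hTn (by rintro _ ⟨v', hv', rfl⟩; linarith [key u hu v hv u' hu' v' hv'])
  have h2 : ∀ u ∈ K, ∀ v ∈ K,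
      sSup (T '' K) ≤ sInf (T '' K) + 2 * (b - a) - S u + S v := fun u hu v hv =>
    csSup_le hTn (by rintro _ ⟨u', hu', rfl⟩; linarith [h1 u hu v hv u' hu'])
  have h3 : ∀ u ∈ K,
      sSup (T '' K) - sInf (T '' K) - 2 * (b - a) + S u ≤ sInf (S '' K) := fun u hu =>
    le_csInf hSn (by rintro _ ⟨v, hv, rfl⟩; linarith [h2 u hu v hv])
  have h4 : sSup (S '' K) ≤ sInf (S '' K) - sSup (T '' K) + sInf (T '' K) + 2 * (b - a) :=
    csSup_le hSn (by rintro _ ⟨u, hu, rfl⟩; linarith [h3 u hu])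
  linarith

lemma lintegral_midpoint_le {f g : ℝ → ℝ≥0∞} (hf : Measurable f) (hg : Measurable g)
    {S T : ℝ → ℝ} (hS : Measurable S) (hT : Measurable T) (hSm : MonotoneOn S (Ioo 0 1))
    (hTm : MonotoneOn T (Ioo 0 1)) (hSlaw : unif.map S = volume.withDensity f)
    (hTlaw : unif.map T = volume.withDensity g) (φ : ℝ → ℝ≥0∞) (hφ : Measurable φ) :
    ∫⁻ u, φ ((1 / 2 : ℝ) • S u + (1 / 2 : ℝ) • T u) *
      (((f (S u))⁻¹ + (g (T u))⁻¹) / 2) ∂unif ≤ ∫⁻ x, φ x := by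
  set M : ℝ → ℝ := fun u => (1 / 2 : ℝ) • S u + (1 / 2 : ℝ) • T u with hMdef
  have hM : Measurable M := by fun_prop
  set s : ℝ → ℝ≥0∞ := fun u => ((f (S u))⁻¹ + (g (T u))⁻¹) / 2
  have hs : Measurable s := by fun_prop
  have hle : (unif.withDensity s).map M ≤ volume := by
    refine le_volume_of_Ioc _ fun a b => ?_
    rcases le_or_gt b a with hab | hab
    · simp [Ioc_eq_empty_of_le hab]
    rw [Measure.map_apply hM measurableSet_Ioc, withDensity_apply _ (hM measurableSet_Ioc)]
    set K := M ⁻¹' Ioc a b ∩ Ioo 0 1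
    have hKm : MeasurableSet K := (hM measurableSet_Ioc).inter measurableSet_Ioo
    have hKeq : ∫⁻ u in M ⁻¹' Ioc a b, s u ∂unif = ∫⁻ u in K, s u ∂unif := by
      have : M ⁻¹' Ioc a b =ᵐ[unif] K := by
        filter_upwards [ae_unif_mem] with u hu
        exact propext ⟨fun h => ⟨h, hu⟩, fun h => h.1⟩
      rw [Measure.restrict_congr_set this]
    obtain ⟨p, q, p', q', hpq, hpq', h1, h2, h3⟩ :=
      exists_Icc_of_midpoint (hSm.mono inter_subset_right : MonotoneOn S K)
        (hTm.mono inter_subset_right) hab.le (fun u hu => Ioc_subset_Icc_self hu.1)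
    rw [hKeq]
    calc ∫⁻ u in K, s u ∂unif
        = (∫⁻ u in K, (f (S u))⁻¹ ∂unif + ∫⁻ u in K, (g (T u))⁻¹ ∂unif) / 2 := by
          rw [← lintegral_add_left (by fun_prop)]
          simp only [s, div_eq_mul_inv]
          rw [lintegral_mul_const _ (by fun_prop)]
      _ ≤ (ENNReal.ofReal (q - p) + ENNReal.ofReal (q' - p')) / 2 := by
          gcongr
          · exact setLIntegral_inv_density_le hf hS hSlaw K p q h1 hKm
          · exact setLIntegral_inv_density_le hg hT hTlaw K p' q' h2 hKm
      _ ≤ ENNReal.ofReal (b - a) := by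
          rw [← ENNReal.ofReal_add (by linarith) (by linarith)]
          refine ENNReal.div_le_of_le_mul ?_
          rw [← ENNReal.ofReal_ofNat 2, ← ENNReal.ofReal_mul (by linarith)]
          exact ENNReal.ofReal_le_ofReal (by linarith)
  calc ∫⁻ u, φ (M u) * s u ∂unif = ∫⁻ x, φ x ∂((unif.withDensity s).map M) := by
        rw [lintegral_map hφ hM, lintegral_withDensity_mul (φ := fun u => φ (M u)) _ hs (hφ.comp hM)]
        simp_rw [mul_comm]
    _ ≤ ∫⁻ x, φ x := lintegral_mono' hle le_rfl

end EntropyTransport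

namespace EntropyTransport

open Set ProbabilityTheory

/-! ### Triangular couplings -/

/-- `(X, Y)` couples the densities `f` and `g` in such a way that the midpoint `(X + Y) / 2` is
spread out: `s` is a lower bound for the Jacobian of the midpoint map, and it dominates the
geometric mean of the Jacobians of `X` and `Y`. -/
structure IsMidTransport {B E : Type} [MeasurableSpace B] [MeasureSpace E] [AddCommGroup E]
    [Module ℝ E] (P : Measure B) (f g : E → ℝ≥0∞) (X Y : B → E) (s : B → ℝ≥0∞) : Prop where
  map_left : P.map X = volume.withDensity f
  map_right : P.map Y = volume.withDensity g
  lintegral_le : ∀ φ : E → ℝ≥0∞, Measurable φ →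
    ∫⁻ u, φ ((1 / 2 : ℝ) • X u + (1 / 2 : ℝ) • Y u) * s u ∂P ≤ ∫⁻ x, φ x
  one_le : ∀ᵐ u ∂P, 1 ≤ s u ^ 2 * f (X u) * g (Y u)

/-- Measurable families of probability densities on `E` admit measurable families of couplings
as in `IsMidTransport`, defined on the probability space `(B, P)`. -/
def HasMidTransport {B : Type} [MeasurableSpace B] (P : Measure B) (E : Type) [MeasureSpace E]
    [AddCommGroup E] [Module ℝ E] : Prop :=
  ∀ (Ω : Type) [MeasurableSpace Ω] (f g : Ω → E → ℝ≥0∞),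
    Measurable (fun p : Ω × E => f p.1 p.2) → Measurable (fun p : Ω × E => g p.1 p.2) →
    (∀ ω, ∫⁻ x, f ω x = 1) → (∀ ω, ∫⁻ x, g ω x = 1) →
    ∃ (X Y : Ω → B → E) (s : Ω → B → ℝ≥0∞), Measurable (fun p : Ω × B => X p.1 p.2) ∧
      Measurable (fun p : Ω × B => Y p.1 p.2) ∧ Measurable (fun p : Ω × B => s p.1 p.2) ∧
      ∀ ω, IsMidTransport P (f ω) (g ω) (X ω) (Y ω) (s ω)

lemma isProbabilityMeasure_withDensity' {E : Type} [MeasureSpace E] {f : E → ℝ≥0∞}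
    (h : ∫⁻ x, f x = 1) : IsProbabilityMeasure ((volume : Measure E).withDensity f) :=
  ⟨by rw [withDensity_apply _ MeasurableSet.univ, Measure.restrict_univ, h]⟩

lemma ae_density_ne {B E : Type} [MeasurableSpace B] [MeasureSpace E] {P : Measure B}
    {f : E → ℝ≥0∞} (hf : Measurable f) (hf1 : ∫⁻ x, f x = 1) {X : B → E} (hX : Measurable X)
    (h : P.map X = volume.withDensity f) : ∀ᵐ u ∂P, f (X u) ≠ 0 ∧ f (X u) ≠ ∞ := by
  refine ae_of_ae_map hX.aemeasurable (p := fun x => f x ≠ 0 ∧ f x ≠ ∞) ?_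
  rw [h, ae_withDensity_iff hf]
  filter_upwards [ae_lt_top hf (by rw [hf1]; exact ENNReal.one_ne_top)] with x hx h0
  exact ⟨h0, hx.ne⟩

lemma one_le_mean_inv_sq_mul {a b : ℝ≥0∞} (ha : a ≠ 0) (ha' : a ≠ ∞) (hb : b ≠ 0)
    (hb' : b ≠ ∞) : 1 ≤ ((a⁻¹ + b⁻¹) / 2) ^ 2 * a * b ∧
      (((a⁻¹ + b⁻¹) / 2) ^ 2 * a * b ≤ 1 → a = b) := by
  lift a to NNReal using ha'
  lift b to NNReal using hb'
  have ha : a ≠ 0 := by simpa using ha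
  have hb : b ≠ 0 := by simpa using hb
  have : (((a : ℝ≥0∞)⁻¹ + (b : ℝ≥0∞)⁻¹) / 2) ^ 2 * a * b =
      ((((a⁻¹ + b⁻¹) / 2) ^ 2 * a * b : NNReal) : ℝ≥0∞) := by
    push_cast [ENNReal.coe_inv ha, ENNReal.coe_inv hb, ENNReal.coe_div (two_ne_zero' NNReal)]
    rfl
  rw [this]
  have hra : 0 < (a : ℝ) := by positivity
  have hrb : 0 < (b : ℝ) := by positivity
  have key : ((((a : ℝ)⁻¹ + (b : ℝ)⁻¹) / 2) ^ 2 * a * b) =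
      1 + ((a : ℝ) - b) ^ 2 / (4 * a * b) := by
    field_simp
    ring
  constructor
  · rw [← ENNReal.coe_one, ENNReal.coe_le_coe, ← NNReal.coe_le_coe]
    push_cast
    rw [key]
    have : 0 ≤ ((a : ℝ) - b) ^ 2 / (4 * a * b) := by positivity
    linarith
  · rw [← ENNReal.coe_one, ENNReal.coe_le_coe, ← NNReal.coe_le_coe, ENNReal.coe_inj,
      ← NNReal.coe_inj]
    push_cast
    rw [key]
    intro h
    have h1 : ((a : ℝ) - b) ^ 2 / (4 * a * b) ≤ 0 := by linarith
    have h2 : ((a : ℝ) - b) ^ 2 ≤ 0 := by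
      rwa [div_le_iff₀ (by positivity), zero_mul] at h1
    nlinarith [sq_nonneg ((a : ℝ) - b), pow_eq_zero_iff (two_ne_zero) |>.1
      (le_antisymm h2 (sq_nonneg _))]

lemma measurable_quantile_withDensity {Ω : Type} [MeasurableSpace Ω] {f : Ω → ℝ → ℝ≥0∞}
    (hf : Measurable fun p : Ω × ℝ => f p.1 p.2) (hf1 : ∀ ω, ∫⁻ x, f ω x = 1) :
    Measurable fun p : Ω × ℝ => quantile (volume.withDensity (f p.1)) p.2 := by
  have := fun ω => isProbabilityMeasure_withDensity' (hf1 ω)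
  refine measurable_quantile (fun ω => volume.withDensity (f ω)) fun x => ?_
  simp_rw [withDensity_apply _ measurableSet_Iic]
  exact hf.lintegral_prod_right'

lemma isMidTransport_quantile {f g : ℝ → ℝ≥0∞} (hf : Measurable f) (hg : Measurable g)
    (hf1 : ∫⁻ x, f x = 1) (hg1 : ∫⁻ x, g x = 1) :
    IsMidTransport unif f g (quantile (volume.withDensity f)) (quantile (volume.withDensity g))
      (fun u => ((f (quantile (volume.withDensity f) u))⁻¹ +
        (g (quantile (volume.withDensity g) u))⁻¹) / 2) := by
  have := isProbabilityMeasure_withDensity' hf1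
  have := isProbabilityMeasure_withDensity' hg1
  refine ⟨map_quantile _, map_quantile _, lintegral_midpoint_le hf hg
    (measurable_quantile_single _) (measurable_quantile_single _) (quantile_mono _)
    (quantile_mono _) (map_quantile _) (map_quantile _), ?_⟩
  filter_upwards [ae_density_ne hf hf1 (measurable_quantile_single _) (map_quantile _),
    ae_density_ne hg hg1 (measurable_quantile_single _) (map_quantile _)] with u h1 h2
  exact (one_le_mean_inv_sq_mul h1.1 h1.2 h2.1 h2.2).1

/-- The first marginal of a density. -/
def margDensity {F : Type} [MeasureSpace F] (f : ℝ × F → ℝ≥0∞) (x : ℝ) : ℝ≥0∞ :=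
  ∫⁻ y, f (x, y)

open Classical in
/-- The conditional density given the first coordinate; where it is not determined, the second
marginal is used. -/
def condDensity {F : Type} [MeasureSpace F] (f : ℝ × F → ℝ≥0∞) (x : ℝ) (y : F) : ℝ≥0∞ :=
  if margDensity f x ≠ 0 ∧ margDensity f x ≠ ∞ then f (x, y) / margDensity f x
  else ∫⁻ x', f (x', y)

lemma margDensity_mul_condDensity {F : Type} [MeasureSpace F] {f : ℝ × F → ℝ≥0∞} {x : ℝ}
    (h : margDensity f x ≠ 0 ∧ margDensity f x ≠ ∞) (y : F) :
    margDensity f x * condDensity f x y = f (x, y) := by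
  rw [condDensity, if_pos h]
  exact ENNReal.mul_div_cancel h.1 h.2

section density

variable {F : Type} [MeasureSpace F] [SFinite (volume : Measure F)]

lemma measurable_margDensity {Ω : Type} [MeasurableSpace Ω] {f : Ω → ℝ × F → ℝ≥0∞}
    (hf : Measurable fun p : Ω × (ℝ × F) => f p.1 p.2) :
    Measurable fun p : Ω × ℝ => margDensity (f p.1) p.2 := by
  have : Measurable fun q : (Ω × ℝ) × F => f q.1.1 (q.1.2, q.2) :=
    hf.comp (measurable_fst.fst.prodMk (measurable_fst.snd.prodMk measurable_snd))
  exact this.lintegral_prod_right'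

lemma measurable_condDensity {Ω : Type} [MeasurableSpace Ω] {f : Ω → ℝ × F → ℝ≥0∞}
    (hf : Measurable fun p : Ω × (ℝ × F) => f p.1 p.2) :
    Measurable fun p : (Ω × ℝ) × F => condDensity (f p.1.1) p.1.2 p.2 := by
  have hm : Measurable fun p : (Ω × ℝ) × F => margDensity (f p.1.1) p.1.2 :=
    (measurable_margDensity hf).comp measurable_fst
  have h1 : Measurable fun p : (Ω × ℝ) × F => f p.1.1 (p.1.2, p.2) :=
    hf.comp (measurable_fst.fst.prodMk (measurable_fst.snd.prodMk measurable_snd))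
  have h2 : Measurable fun q : ((Ω × ℝ) × F) × ℝ => f q.1.1.1 (q.2, q.1.2) :=
    hf.comp (measurable_fst.fst.fst.prodMk (measurable_snd.prodMk measurable_fst.snd))
  refine Measurable.ite ?_ (h1.div hm) h2.lintegral_prod_right'
  exact (hm (measurableSet_singleton 0).compl).inter (hm (measurableSet_singleton ∞).compl)

lemma measurable_margDensity_single {f : ℝ × F → ℝ≥0∞} (hf : Measurable f) :
    Measurable (margDensity f) :=
  (measurable_margDensity (Ω := Unit) (f := fun _ => f) (hf.comp measurable_snd)).comp
    (measurable_const.prodMk measurable_id : Measurable fun u : ℝ => ((), u))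

lemma measurable_condDensity_single {f : ℝ × F → ℝ≥0∞} (hf : Measurable f) :
    Measurable fun p : ℝ × F => condDensity f p.1 p.2 :=
  (measurable_condDensity (Ω := Unit) (f := fun _ => f) (hf.comp measurable_snd)).comp
    ((measurable_const.prodMk measurable_fst).prodMk measurable_snd :
      Measurable fun p : ℝ × F => (((), p.1), p.2))

lemma lintegral_margDensity {f : ℝ × F → ℝ≥0∞} (hf : Measurable f) :
    ∫⁻ x, margDensity f x = ∫⁻ p, f p := by
  rw [Measure.volume_eq_prod, lintegral_prod _ hf.aemeasurable]
  rfl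

lemma lintegral_condDensity {f : ℝ × F → ℝ≥0∞} (hf : Measurable f) (hf1 : ∫⁻ p, f p = 1)
    (x : ℝ) : ∫⁻ y, condDensity f x y = 1 := by
  by_cases h : margDensity f x ≠ 0 ∧ margDensity f x ≠ ∞
  · simp_rw [condDensity, if_pos h, div_eq_mul_inv]
    have hfx : Measurable fun y => f (x, y) := hf.comp measurable_prodMk_left
    rw [lintegral_mul_const _ hfx]
    exact ENNReal.mul_inv_cancel h.1 h.2
  · simp_rw [condDensity, if_neg h]
    rw [← hf1, Measure.volume_eq_prod, lintegral_prod_symm _ hf.aemeasurable]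

end density

section prod

variable {F B : Type} [MeasureSpace F] [SFinite (volume : Measure F)] [MeasurableSpace B]
  {P : Measure B} [IsProbabilityMeasure P]

lemma map_triangular {f : ℝ × F → ℝ≥0∞} (hf : Measurable f) (hf1 : ∫⁻ p, f p = 1)
    {S : ℝ → ℝ} (hS : Measurable S) (hSlaw : unif.map S = volume.withDensity (margDensity f))
    {X : ℝ → B → F} (hX : Measurable fun p : ℝ × B => X p.1 p.2)
    (hXlaw : ∀ u, P.map (X u) = volume.withDensity (condDensity f (S u))) :
    (unif.prod P).map (fun p => (S p.1, X p.1 p.2)) = volume.withDensity f := by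
  have hmap : Measurable fun p : ℝ × B => (S p.1, X p.1 p.2) :=
    (hS.comp measurable_fst).prodMk hX
  have hm := measurable_margDensity_single hf
  have hc := measurable_condDensity_single hf
  refine Measure.ext_of_lintegral _ fun φ hφ => ?_
  have hcomp : Measurable fun p : ℝ × B => φ (S p.1, X p.1 p.2) := hφ.comp hmap
  rw [lintegral_map hφ hmap, lintegral_prod _ hcomp.aemeasurable]
  have hinner : Measurable fun x => ∫⁻ y, condDensity f x y * φ (x, y) :=
    (hc.mul hφ).lintegral_prod_right'
  calc ∫⁻ u, ∫⁻ v, φ (S u, X u v) ∂P ∂unif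
      = ∫⁻ u, (∫⁻ y, condDensity f (S u) y * φ (S u, y)) ∂unif := by
        refine lintegral_congr fun u => ?_
        have h1 : Measurable fun y => φ (S u, y) := hφ.comp measurable_prodMk_left
        have h2 : Measurable (condDensity f (S u)) := hc.comp measurable_prodMk_left
        have h3 : Measurable (X u) := hX.comp measurable_prodMk_left
        rw [← lintegral_withDensity_mul _ h2 h1, ← hXlaw u, lintegral_map h1 h3]
    _ = ∫⁻ x, (∫⁻ y, condDensity f x y * φ (x, y)) ∂(unif.map S) :=
        (lintegral_map hinner hS).symm
    _ = ∫⁻ x, margDensity f x * ∫⁻ y, condDensity f x y * φ (x, y) := by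
        rw [hSlaw, lintegral_withDensity_mul _ hm hinner]
    _ = ∫⁻ x, ∫⁻ y, f (x, y) * φ (x, y) := by
        have hfin : ∀ᵐ x, margDensity f x < ∞ :=
          ae_lt_top hm (by rw [lintegral_margDensity hf, hf1]; exact ENNReal.one_ne_top)
        refine lintegral_congr_ae ?_
        filter_upwards [hfin] with x hx
        by_cases h0 : margDensity f x = 0
        · have : ∀ᵐ y, f (x, y) = 0 :=
            (lintegral_eq_zero_iff (hf.comp measurable_prodMk_left)).1 h0
          rw [h0, zero_mul]
          refine ((lintegral_congr_ae ?_).trans lintegral_zero).symm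
          filter_upwards [this] with y hy
          rw [hy, zero_mul]
        · have hxm : Measurable fun y => condDensity f x y * φ (x, y) :=
            (hc.comp measurable_prodMk_left).mul (hφ.comp measurable_prodMk_left)
          rw [← lintegral_const_mul _ hxm]
          refine lintegral_congr fun y => ?_
          rw [← mul_assoc]
          exact congrArg (· * φ (x, y)) (margDensity_mul_condDensity ⟨h0, hx.ne⟩ y)
    _ = ∫⁻ p, φ p ∂(volume.withDensity f) := by
        have hfφ : Measurable fun p => f p * φ p := hf.mul hφ
        rw [lintegral_withDensity_mul _ hf hφ, Measure.volume_eq_prod,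
          lintegral_prod _ hfφ.aemeasurable]

end prod

end EntropyTransport

namespace EntropyTransport

open Set ProbabilityTheory

section prod

variable {F B : Type} [MeasureSpace F] [SFinite (volume : Measure F)] [MeasurableSpace B]
  {P : Measure B} [IsProbabilityMeasure P]

lemma triangular_one_le {f g : ℝ × F → ℝ≥0∞} (hf : Measurable f) (hg : Measurable g)
    (hf1 : ∫⁻ p, f p = 1) (hg1 : ∫⁻ p, g p = 1) {S T : ℝ → ℝ} (hS : Measurable S)
    (hT : Measurable T) (hSlaw : unif.map S = volume.withDensity (margDensity f))
    (hTlaw : unif.map T = volume.withDensity (margDensity g))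
    {X Y : ℝ → B → F} (hX : Measurable fun p : ℝ × B => X p.1 p.2)
    (hY : Measurable fun p : ℝ × B => Y p.1 p.2)
    {s : ℝ → B → ℝ≥0∞} (hs : Measurable fun p : ℝ × B => s p.1 p.2)
    (h : ∀ u, ∀ᵐ v ∂P, 1 ≤ s u v ^ 2 * condDensity f (S u) (X u v) * condDensity g (T u) (Y u v)) :
    ∀ᵐ p ∂(unif.prod P),
      1 ≤ (((margDensity f (S p.1))⁻¹ + (margDensity g (T p.1))⁻¹) / 2 * s p.1 p.2) ^ 2 *
        f (S p.1, X p.1 p.2) * g (T p.1, Y p.1 p.2) ∧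
      ((((margDensity f (S p.1))⁻¹ + (margDensity g (T p.1))⁻¹) / 2 * s p.1 p.2) ^ 2 *
        f (S p.1, X p.1 p.2) * g (T p.1, Y p.1 p.2) ≤ 1 →
        margDensity f (S p.1) = margDensity g (T p.1)) := by
  have hcf : Measurable fun p : ℝ × B => condDensity f (S p.1) (X p.1 p.2) :=
    (measurable_condDensity_single hf).comp ((hS.comp measurable_fst).prodMk hX)
  have hcg : Measurable fun p : ℝ × B => condDensity g (T p.1) (Y p.1 p.2) :=
    (measurable_condDensity_single hg).comp ((hT.comp measurable_fst).prodMk hY)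
  have hE : ∀ᵐ p ∂(unif.prod P), 1 ≤ s p.1 p.2 ^ 2 * condDensity f (S p.1) (X p.1 p.2) *
      condDensity g (T p.1) (Y p.1 p.2) := by
    refine (Measure.ae_prod_iff_ae_ae ?_).2 (ae_of_all _ fun u => h u)
    exact measurableSet_le measurable_const (((hs.pow_const 2).mul hcf).mul hcg)
  have hf2 : ∫⁻ x, margDensity f x = 1 := by rw [lintegral_margDensity hf, hf1]
  have hg2 : ∫⁻ x, margDensity g x = 1 := by rw [lintegral_margDensity hg, hg1]
  have e1 : ∀ᵐ p ∂(unif.prod P), margDensity f (S p.1) ≠ 0 ∧ margDensity f (S p.1) ≠ ∞ :=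
    Measure.quasiMeasurePreserving_fst.ae
      (ae_density_ne (measurable_margDensity_single hf) hf2 hS hSlaw)
  have e2 : ∀ᵐ p ∂(unif.prod P), margDensity g (T p.1) ≠ 0 ∧ margDensity g (T p.1) ≠ ∞ :=
    Measure.quasiMeasurePreserving_fst.ae
      (ae_density_ne (measurable_margDensity_single hg) hg2 hT hTlaw)
  filter_upwards [hE, e1, e2] with p hp hp1 hp2
  have h12 := one_le_mean_inv_sq_mul hp1.1 hp1.2 hp2.1 hp2.2
  set r := ((margDensity f (S p.1))⁻¹ + (margDensity g (T p.1))⁻¹) / 2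
  have e : (r * s p.1 p.2) ^ 2 * f (S p.1, X p.1 p.2) * g (T p.1, Y p.1 p.2) =
      (r ^ 2 * margDensity f (S p.1) * margDensity g (T p.1)) *
        (s p.1 p.2 ^ 2 * condDensity f (S p.1) (X p.1 p.2) *
          condDensity g (T p.1) (Y p.1 p.2)) := by
    rw [← margDensity_mul_condDensity hp1, ← margDensity_mul_condDensity hp2]
    ring
  rw [e]
  exact ⟨one_le_mul h12.1 hp, fun hle => h12.2 ((le_mul_of_one_le_right' hp).trans hle)⟩

variable [AddCommGroup F] [Module ℝ F] [MeasurableAdd₂ F] [MeasurableConstSMul ℝ F]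

lemma triangular_lintegral_le {S T : ℝ → ℝ} {r : ℝ → ℝ≥0∞} (hS : Measurable S)
    (hT : Measurable T) (hr : Measurable r)
    (hST : ∀ φ : ℝ → ℝ≥0∞, Measurable φ →
      ∫⁻ u, φ ((1 / 2 : ℝ) • S u + (1 / 2 : ℝ) • T u) * r u ∂unif ≤ ∫⁻ x, φ x)
    {X Y : ℝ → B → F} (hX : Measurable fun p : ℝ × B => X p.1 p.2)
    (hY : Measurable fun p : ℝ × B => Y p.1 p.2)
    {s : ℝ → B → ℝ≥0∞} (hs : Measurable fun p : ℝ × B => s p.1 p.2)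
    (hXY : ∀ u, ∀ φ : F → ℝ≥0∞, Measurable φ →
      ∫⁻ v, φ ((1 / 2 : ℝ) • X u v + (1 / 2 : ℝ) • Y u v) * s u v ∂P ≤ ∫⁻ x, φ x)
    {φ : ℝ × F → ℝ≥0∞} (hφ : Measurable φ) :
    ∫⁻ p, φ ((1 / 2 : ℝ) • (S p.1, X p.1 p.2) + (1 / 2 : ℝ) • (T p.1, Y p.1 p.2)) *
      (r p.1 * s p.1 p.2) ∂(unif.prod P) ≤ ∫⁻ p, φ p := by
  set m : ℝ → ℝ := fun u => (1 / 2 : ℝ) • S u + (1 / 2 : ℝ) • T u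
  set M : ℝ → B → F := fun u v => (1 / 2 : ℝ) • X u v + (1 / 2 : ℝ) • Y u v
  have hm : Measurable m := (hS.const_smul (1 / 2 : ℝ)).add (hT.const_smul (1 / 2 : ℝ))
  have hM : Measurable fun p : ℝ × B => M p.1 p.2 := (hX.const_smul _).add (hY.const_smul _)
  have hφM : Measurable fun p : ℝ × B => φ (m p.1, M p.1 p.2) :=
    hφ.comp ((hm.comp measurable_fst).prodMk hM)
  have hall : Measurable fun p : ℝ × B => φ (m p.1, M p.1 p.2) * (r p.1 * s p.1 p.2) :=
    hφM.mul ((hr.comp measurable_fst).mul hs)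
  calc ∫⁻ p, φ (m p.1, M p.1 p.2) * (r p.1 * s p.1 p.2) ∂(unif.prod P)
      = ∫⁻ u, ∫⁻ v, φ (m u, M u v) * (r u * s u v) ∂P ∂unif :=
        lintegral_prod _ hall.aemeasurable
    _ ≤ ∫⁻ u, (∫⁻ y, φ (m u, y)) * r u ∂unif := by
        refine lintegral_mono fun u => ?_
        have h1 := hXY u (fun y => φ (m u, y)) (hφ.comp measurable_prodMk_left)
        have h2 : Measurable fun v => φ (m u, M u v) * s u v :=
          (hφM.comp measurable_prodMk_left).mul (hs.comp measurable_prodMk_left)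
        calc ∫⁻ v, φ (m u, M u v) * (r u * s u v) ∂P
            = (∫⁻ v, φ (m u, M u v) * s u v ∂P) * r u := by
              rw [← lintegral_mul_const _ h2]
              exact lintegral_congr fun v => by ring
          _ ≤ _ := mul_le_mul_left h1 (r u)
    _ ≤ ∫⁻ x, ∫⁻ y, φ (x, y) := hST _ hφ.lintegral_prod_right'
    _ = ∫⁻ p, φ p := by
        rw [Measure.volume_eq_prod, lintegral_prod _ hφ.aemeasurable]

lemma isMidTransport_triangular {f g : ℝ × F → ℝ≥0∞} (hf : Measurable f) (hg : Measurable g)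
    (hf1 : ∫⁻ p, f p = 1) (hg1 : ∫⁻ p, g p = 1)
    {X Y : ℝ → B → F} (hX : Measurable fun p : ℝ × B => X p.1 p.2)
    (hY : Measurable fun p : ℝ × B => Y p.1 p.2)
    {s : ℝ → B → ℝ≥0∞} (hs : Measurable fun p : ℝ × B => s p.1 p.2) {S T : ℝ → ℝ}
    (hS : S = quantile (volume.withDensity (margDensity f)))
    (hT : T = quantile (volume.withDensity (margDensity g)))
    (h : ∀ u, IsMidTransport P (condDensity f (S u)) (condDensity g (T u)) (X u) (Y u) (s u)) :
    IsMidTransport (unif.prod P) f g (fun p => (S p.1, X p.1 p.2)) (fun p => (T p.1, Y p.1 p.2))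
      (fun p => ((margDensity f (S p.1))⁻¹ + (margDensity g (T p.1))⁻¹) / 2 * s p.1 p.2) ∧
    ∀ᵐ p ∂(unif.prod P),
      (((margDensity f (S p.1))⁻¹ + (margDensity g (T p.1))⁻¹) / 2 * s p.1 p.2) ^ 2 *
        f (S p.1, X p.1 p.2) * g (T p.1, Y p.1 p.2) ≤ 1 →
        margDensity f (S p.1) = margDensity g (T p.1) := by
  have hfm := measurable_margDensity_single hf
  have hgm := measurable_margDensity_single hg
  have hf2 : ∫⁻ x, margDensity f x = 1 := by rw [lintegral_margDensity hf, hf1]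
  have hg2 : ∫⁻ x, margDensity g x = 1 := by rw [lintegral_margDensity hg, hg1]
  have := isProbabilityMeasure_withDensity' hf2
  have := isProbabilityMeasure_withDensity' hg2
  have h1 := isMidTransport_quantile hfm hgm hf2 hg2
  have hSm : Measurable S := by rw [hS]; exact measurable_quantile_single _
  have hTm : Measurable T := by rw [hT]; exact measurable_quantile_single _
  rw [← hS, ← hT] at h1
  have hone := triangular_one_le hf hg hf1 hg1 hSm hTm h1.map_left h1.map_right hX hY hs
    fun u => (h u).one_le
  refine ⟨⟨map_triangular hf hf1 hSm h1.map_left hX fun u => (h u).map_left,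
    map_triangular hg hg1 hTm h1.map_right hY fun u => (h u).map_right, fun φ hφ => ?_,
    hone.mono fun p hp => hp.1⟩, hone.mono fun p hp => hp.2⟩
  exact triangular_lintegral_le hSm hTm
    (((hfm.comp hSm).inv.add (hgm.comp hTm).inv).div_const 2) h1.lintegral_le hX hY hs
    (fun u => (h u).lintegral_le) hφ

lemma HasMidTransport.prod (hF : HasMidTransport P F) :
    HasMidTransport (unif.prod P) (ℝ × F) := by
  intro Ω _ f g hf hg hf1 hg1
  have hfω : ∀ ω, Measurable (f ω) := fun ω => hf.comp measurable_prodMk_left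
  have hgω : ∀ ω, Measurable (g ω) := fun ω => hg.comp measurable_prodMk_left
  have hfm := measurable_margDensity hf
  have hgm := measurable_margDensity hg
  have hfm1 : ∀ ω, ∫⁻ x, margDensity (f ω) x = 1 := fun ω => by
    rw [lintegral_margDensity (hfω ω), hf1]
  have hgm1 : ∀ ω, ∫⁻ x, margDensity (g ω) x = 1 := fun ω => by
    rw [lintegral_margDensity (hgω ω), hg1]
  have hS0 := measurable_quantile_withDensity (f := fun ω => margDensity (f ω)) hfm hfm1
  have hT0 := measurable_quantile_withDensity (f := fun ω => margDensity (g ω)) hgm hgm1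
  obtain ⟨S, hSdef⟩ : ∃ S : Ω → ℝ → ℝ,
    S = fun ω => quantile (volume.withDensity (margDensity (f ω))) := ⟨_, rfl⟩
  obtain ⟨T, hTdef⟩ : ∃ T : Ω → ℝ → ℝ,
    T = fun ω => quantile (volume.withDensity (margDensity (g ω))) := ⟨_, rfl⟩
  have hS : Measurable fun p : Ω × ℝ => S p.1 p.2 := by rw [hSdef]; exact hS0
  have hT : Measurable fun p : Ω × ℝ => T p.1 p.2 := by rw [hTdef]; exact hT0
  obtain ⟨X, Y, s, hX, hY, hs, h⟩ := hF (Ω × ℝ)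
    (fun q => condDensity (f q.1) (S q.1 q.2)) (fun q => condDensity (g q.1) (T q.1 q.2))
    ((measurable_condDensity hf).comp
      ((measurable_fst.fst.prodMk (hS.comp measurable_fst)).prodMk measurable_snd))
    ((measurable_condDensity hg).comp
      ((measurable_fst.fst.prodMk (hT.comp measurable_fst)).prodMk measurable_snd))
    (fun q => lintegral_condDensity (hfω q.1) (hf1 q.1) _)
    (fun q => lintegral_condDensity (hgω q.1) (hg1 q.1) _)
  have hpair : Measurable fun p : Ω × (ℝ × B) => (p.1, p.2.1) :=
    measurable_fst.prodMk measurable_snd.fst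
  have htriple : Measurable fun p : Ω × (ℝ × B) => ((p.1, p.2.1), p.2.2) :=
    hpair.prodMk measurable_snd.snd
  have hassoc : ∀ ω : Ω, Measurable fun p : ℝ × B => ((ω, p.1), p.2) := fun ω =>
    (measurable_const.prodMk measurable_fst).prodMk measurable_snd
  have hr : Measurable fun p : Ω × ℝ =>
      ((margDensity (f p.1) (S p.1 p.2))⁻¹ + (margDensity (g p.1) (T p.1 p.2))⁻¹) / 2 :=
    ((hfm.comp (measurable_fst.prodMk hS)).inv.add
      (hgm.comp (measurable_fst.prodMk hT)).inv).div_const 2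
  have hXω : ∀ ω, Measurable fun p : ℝ × B => X (ω, p.1) p.2 := fun ω => hX.comp (hassoc ω)
  have hYω : ∀ ω, Measurable fun p : ℝ × B => Y (ω, p.1) p.2 := fun ω => hY.comp (hassoc ω)
  have hsω : ∀ ω, Measurable fun p : ℝ × B => s (ω, p.1) p.2 := fun ω => hs.comp (hassoc ω)
  refine ⟨fun ω p => (S ω p.1, X (ω, p.1) p.2), fun ω p => (T ω p.1, Y (ω, p.1) p.2),
    fun ω p => ((margDensity (f ω) (S ω p.1))⁻¹ + (margDensity (g ω) (T ω p.1))⁻¹) / 2 *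
      s (ω, p.1) p.2, ?_, ?_, ?_, fun ω => ?_⟩
  · exact (hS.comp hpair).prodMk (hX.comp htriple)
  · exact (hT.comp hpair).prodMk (hY.comp htriple)
  · exact (hr.comp hpair).mul (hs.comp htriple)
  · exact (isMidTransport_triangular (hfω ω) (hgω ω) (hf1 ω) (hg1 ω)
      (X := fun u => X (ω, u)) (Y := fun u => Y (ω, u)) (s := fun u => s (ω, u))
      (hXω ω) (hYω ω) (hsω ω) (congrFun hSdef ω) (congrFun hTdef ω) fun u => h (ω, u)).1

lemma exists_isMidTransport_prod (hF : HasMidTransport P F) {f g : ℝ × F → ℝ≥0∞}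
    (hf : Measurable f) (hg : Measurable g) (hf1 : ∫⁻ x, f x = 1) (hg1 : ∫⁻ x, g x = 1) :
    ∃ (X Y : ℝ × B → ℝ × F) (s : ℝ × B → ℝ≥0∞), Measurable X ∧ Measurable Y ∧ Measurable s ∧
      IsMidTransport (unif.prod P) f g X Y s ∧
        (∀ p, (X p).1 = quantile (volume.withDensity (margDensity f)) p.1) ∧
        (∀ p, (Y p).1 = quantile (volume.withDensity (margDensity g)) p.1) ∧
        ∀ᵐ p ∂(unif.prod P), s p ^ 2 * f (X p) * g (Y p) ≤ 1 →
          margDensity f (X p).1 = margDensity g (Y p).1 := by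
  set S : ℝ → ℝ := quantile (volume.withDensity (margDensity f)) with hSdef
  set T : ℝ → ℝ := quantile (volume.withDensity (margDensity g)) with hTdef
  have hfm := measurable_margDensity_single hf
  have hgm := measurable_margDensity_single hg
  have hf2 : ∫⁻ x, margDensity f x = 1 := by rw [lintegral_margDensity hf, hf1]
  have hg2 : ∫⁻ x, margDensity g x = 1 := by rw [lintegral_margDensity hg, hg1]
  have := isProbabilityMeasure_withDensity' hf2
  have := isProbabilityMeasure_withDensity' hg2
  have hS : Measurable S := measurable_quantile_single _
  have hT : Measurable T := measurable_quantile_single _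
  obtain ⟨X, Y, s, hX, hY, hs, h⟩ := hF ℝ
    (fun u => condDensity f (S u)) (fun u => condDensity g (T u))
    ((measurable_condDensity_single hf).comp ((hS.comp measurable_fst).prodMk measurable_snd))
    ((measurable_condDensity_single hg).comp ((hT.comp measurable_fst).prodMk measurable_snd))
    (fun u => lintegral_condDensity hf hf1 _) (fun u => lintegral_condDensity hg hg1 _)
  have key := isMidTransport_triangular hf hg hf1 hg1 hX hY hs hSdef hTdef h
  have hr : Measurable fun u => ((margDensity f (S u))⁻¹ + (margDensity g (T u))⁻¹) / 2 :=
    ((hfm.comp hS).inv.add (hgm.comp hT).inv).div_const 2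
  exact ⟨_, _, _, (hS.comp measurable_fst).prodMk hX, (hT.comp measurable_fst).prodMk hY,
    (hr.comp measurable_fst).mul hs, key.1, fun _ => rfl, fun _ => rfl, key.2⟩

end prod

/-- Midpoint transports are preserved under linear measure preserving isomorphisms. -/
lemma IsMidTransport.map_equiv {B E F : Type} [MeasurableSpace B] [MeasureSpace E]
    [AddCommGroup E] [Module ℝ E] [MeasureSpace F] [AddCommGroup F] [Module ℝ F]
    {P : Measure B} {f g : E → ℝ≥0∞} (hf : Measurable f) (hg : Measurable g) {X Y : B → F}
    {s : B → ℝ≥0∞} (hX : Measurable X) (hY : Measurable Y) (e : F ≃ᵐ E)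
    (he : MeasurePreserving e) (hadd : ∀ x y, e ((1 / 2 : ℝ) • x + (1 / 2 : ℝ) • y) =
      (1 / 2 : ℝ) • e x + (1 / 2 : ℝ) • e y)
    (h : IsMidTransport P (fun x => f (e x)) (fun x => g (e x)) X Y s) :
    IsMidTransport P f g (fun u => e (X u)) (fun u => e (Y u)) s := by
  have hmap : ∀ f : E → ℝ≥0∞, Measurable f →
      ((volume : Measure F).withDensity fun x => f (e x)).map e = volume.withDensity f := by
    intro f hf
    refine Measure.ext_of_lintegral _ fun φ hφ => ?_
    have hfe : Measurable fun x => f (e x) := hf.comp e.measurable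
    have hφe : Measurable fun x => φ (e x) := hφ.comp e.measurable
    have hfφ : Measurable fun x => f x * φ x := hf.mul hφ
    rw [lintegral_map hφ e.measurable, lintegral_withDensity_mul _ hfe hφe,
      lintegral_withDensity_mul _ hf hφ, ← he.lintegral_comp hfφ]
  refine ⟨?_, ?_, fun φ hφ => ?_, h.one_le⟩
  · rw [← hmap f hf, ← h.map_left, Measure.map_map e.measurable hX]
    rfl
  · rw [← hmap g hg, ← h.map_right, Measure.map_map e.measurable hY]
    rfl
  · simp_rw [← hadd]
    rw [← he.lintegral_comp hφ]
    exact h.lintegral_le (fun x => φ (e x)) (hφ.comp e.measurable)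

lemma HasMidTransport.map_equiv {B E F : Type} [MeasurableSpace B] [MeasureSpace E]
    [AddCommGroup E] [Module ℝ E] [MeasureSpace F] [AddCommGroup F] [Module ℝ F]
    {P : Measure B} (h : HasMidTransport P F) (e : F ≃ᵐ E) (he : MeasurePreserving e)
    (hadd : ∀ x y, e ((1 / 2 : ℝ) • x + (1 / 2 : ℝ) • y) =
      (1 / 2 : ℝ) • e x + (1 / 2 : ℝ) • e y) : HasMidTransport P E := by
  intro Ω _ f g hf hg hf1 hg1
  have hfω : ∀ ω, Measurable (f ω) := fun ω => hf.comp measurable_prodMk_left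
  have hgω : ∀ ω, Measurable (g ω) := fun ω => hg.comp measurable_prodMk_left
  obtain ⟨X, Y, s, hX, hY, hs, hXY⟩ := h Ω (fun ω x => f ω (e x)) (fun ω x => g ω (e x))
    (hf.comp (measurable_fst.prodMk (e.measurable.comp measurable_snd)))
    (hg.comp (measurable_fst.prodMk (e.measurable.comp measurable_snd)))
    (fun ω => by rw [he.lintegral_comp (hfω ω), hf1])
    (fun ω => by rw [he.lintegral_comp (hgω ω), hg1])
  exact ⟨fun ω u => e (X ω u), fun ω u => e (Y ω u), s, e.measurable.comp hX,
    e.measurable.comp hY, hs, fun ω => (hXY ω).map_equiv (hfω ω) (hgω ω) (hX.comp measurable_prodMk_left)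
      (hY.comp measurable_prodMk_left) e he hadd⟩

lemma hasMidTransport_pi (n : ℕ) : ∃ (B : Type) (_ : MeasurableSpace B) (P : Measure B),
    IsProbabilityMeasure P ∧ HasMidTransport P (Fin n → ℝ) := by
  induction n with
  | zero =>
    refine ⟨Unit, inferInstance, Measure.dirac (), inferInstance, ?_⟩
    intro Ω _ f g hf hg hf1 hg1
    have hvol : (volume : Measure (Fin 0 → ℝ)) = Measure.dirac default := by
      rw [volume_pi, Measure.pi_of_empty]
      exact congrArg Measure.dirac (Subsingleton.elim _ _)
    have hval : ∀ h : (Fin 0 → ℝ) → ℝ≥0∞, ∫⁻ x, h x = 1 → h = fun _ => 1 := by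
      intro h hh
      funext x
      rw [hvol, lintegral_dirac] at hh
      rw [Subsingleton.elim x default, hh]
    have hlaw : (Measure.dirac ()).map (fun _ => (default : Fin 0 → ℝ)) =
        (volume : Measure (Fin 0 → ℝ)).withDensity fun _ => 1 := by
      rw [show (fun _ : Fin 0 → ℝ => (1 : ℝ≥0∞)) = 1 from rfl, withDensity_one, hvol,
        Measure.map_dirac' measurable_const]
    refine ⟨fun _ _ => default, fun _ _ => default, fun _ _ => 1, measurable_const,
      measurable_const, measurable_const, fun ω => ?_⟩
    rw [hval _ (hf1 ω), hval _ (hg1 ω)]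
    refine ⟨hlaw, hlaw, fun φ hφ => ?_, by simp⟩
    rw [hvol, lintegral_dirac, lintegral_dirac, mul_one]
    exact le_of_eq (congrArg φ (Subsingleton.elim _ _))
  | succ n ih =>
    obtain ⟨B, _, P, _, hP⟩ := ih
    refine ⟨ℝ × B, inferInstance, unif.prod P, inferInstance, ?_⟩
    have hmp := (volume_preserving_piFinSuccAbove (fun _ : Fin (n + 1) => ℝ) 0).symm
    refine hP.prod.map_equiv _ hmp fun x y => ?_
    funext i
    refine Fin.cases ?_ (fun j => ?_) i <;>
      simp [MeasurableEquiv.piFinSuccAbove, Fin.insertNthEquiv]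

end EntropyTransport

namespace EntropyTransport

open Set ProbabilityTheory

/-! ### Extended integrals and the entropy -/

section extended

variable {α : Type*} [MeasurableSpace α] {ν : Measure α} {φ : α → ℝ}

lemma lintegral_ofReal_ne_top (h : Integrable φ ν) : ∫⁻ x, ENNReal.ofReal (φ x) ∂ν ≠ ∞ :=
  h.lintegral_lt_top.ne

lemma integrable_of_lintegral_ofReal (hφ : AEStronglyMeasurable φ ν)
    (h : ∫⁻ x, ENNReal.ofReal (φ x) ∂ν ≠ ∞) (h' : ∫⁻ x, ENNReal.ofReal (-φ x) ∂ν ≠ ∞) :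
    Integrable φ ν := by
  refine ⟨hφ, ?_⟩
  have : ∀ x, ‖φ x‖ₑ = ENNReal.ofReal (φ x) + ENNReal.ofReal (-φ x) := by
    intro x
    rw [← ofReal_norm, Real.norm_eq_abs]
    rcases le_total 0 (φ x) with h | h
    · rw [abs_of_nonneg h, ENNReal.ofReal_of_nonpos (neg_nonpos.2 h), add_zero]
    · rw [abs_of_nonpos h, ENNReal.ofReal_of_nonpos h, zero_add]
  have hm : AEMeasurable (fun x => ENNReal.ofReal (φ x)) ν := hφ.aemeasurable.ennreal_ofReal
  simp_rw [HasFiniteIntegral, this]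
  rw [lintegral_add_left' hm]
  exact ENNReal.add_lt_top.2 ⟨h.lt_top, h'.lt_top⟩

lemma coe_lintegral_sub_eq_integral (h : Integrable φ ν) :
    ((∫⁻ x, ENNReal.ofReal (φ x) ∂ν : ℝ≥0∞) : EReal) - (∫⁻ x, ENNReal.ofReal (-φ x) ∂ν : ℝ≥0∞) =
      ((∫ x, φ x ∂ν : ℝ) : EReal) := by
  have hn : ∫⁻ x, ENNReal.ofReal (-φ x) ∂ν ≠ ∞ := lintegral_ofReal_ne_top h.neg
  rw [integral_eq_lintegral_pos_part_sub_lintegral_neg_part h, EReal.coe_sub,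
    EReal.coe_ennreal_toReal (lintegral_ofReal_ne_top h),
    EReal.coe_ennreal_toReal hn]

lemma coe_sub_eq_bot {a b : ℝ≥0∞} (h : b = ∞) : (a : EReal) - b = ⊥ := by
  rw [h, EReal.coe_ennreal_top, EReal.sub_top]

end extended

variable {d : ℕ}

/-- The logarithm of the density. -/
def logDens (ρ : Measure (Ed d)) (x : Ed d) : ℝ := Real.log (ρ.rnDeriv volume x).toReal

lemma measurable_logDens (ρ : Measure (Ed d)) : Measurable (logDens ρ) :=
  (Measure.measurable_rnDeriv _ _).ennreal_toReal.log

lemma lintegral_rnDeriv_mul {ρ : Measure (Ed d)} [SigmaFinite ρ] (hρ : ρ ≪ volume)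
    {φ : Ed d → ℝ≥0∞} (hφ : Measurable φ) :
    ∫⁻ x, ρ.rnDeriv volume x * φ x = ∫⁻ x, φ x ∂ρ := by
  conv_rhs => rw [← Measure.withDensity_rnDeriv_eq ρ volume hρ]
  rw [lintegral_withDensity_mul _ (Measure.measurable_rnDeriv _ _) hφ]

lemma entropy_eq {ρ : Measure (Ed d)} [SigmaFinite ρ] (hρ : ρ ≪ volume) :
    entropy ρ = ((∫⁻ x, ENNReal.ofReal (logDens ρ x) ∂ρ : ℝ≥0∞) : EReal) -
      (∫⁻ x, ENNReal.ofReal (-logDens ρ x) ∂ρ : ℝ≥0∞) := by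
  have key : ∀ c : ℝ, ∫⁻ x, ENNReal.ofReal ((ρ.rnDeriv volume x).toReal * (c * logDens ρ x)) =
      ∫⁻ x, ENNReal.ofReal (c * logDens ρ x) ∂ρ := by
    intro c
    rw [← lintegral_rnDeriv_mul hρ ((measurable_logDens ρ).const_mul c).ennreal_ofReal]
    refine lintegral_congr_ae ?_
    filter_upwards [Measure.rnDeriv_lt_top ρ volume] with x hx
    rw [ENNReal.ofReal_mul ENNReal.toReal_nonneg, ENNReal.ofReal_toReal hx.ne]
  rw [entropy, if_pos hρ]
  have h1 := key 1
  have h2 := key (-1)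
  simp only [one_mul, neg_mul, mul_neg] at h1 h2
  rw [← h1, ← h2]
  rfl

lemma ae_rnDeriv_ne {ρ : Measure (Ed d)} [SigmaFinite ρ] (hρ : ρ ≪ volume) :
    ∀ᵐ x ∂ρ, ρ.rnDeriv volume x ≠ 0 ∧ ρ.rnDeriv volume x ≠ ∞ := by
  filter_upwards [Measure.rnDeriv_pos hρ, hρ.ae_le (Measure.rnDeriv_lt_top ρ volume)] with x h1 h2
  exact ⟨h1.ne', h2.ne⟩

/-- The entropy of an image measure is controlled by any lower bound for the Jacobian. -/
lemma entropy_map_le {B : Type} [MeasurableSpace B] {P : Measure B} [IsProbabilityMeasure P]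
    {M : B → Ed d} (hM : Measurable M) {r : B → ℝ} (hr : Integrable r P)
    (h : ∀ φ : Ed d → ℝ≥0∞, Measurable φ →
      ∫⁻ u, φ (M u) * ENNReal.ofReal (exp (-r u)) ∂P ≤ ∫⁻ x, φ x) :
    entropy (P.map M) ≤ ((∫ u, r u ∂P : ℝ) : EReal) := by
  set ρ := P.map M
  have : IsProbabilityMeasure ρ := Measure.isProbabilityMeasure_map hM.aemeasurable
  have hre : AEMeasurable (fun u => ENNReal.ofReal (exp (-r u))) P :=
    (hr.aemeasurable.neg.exp).ennreal_ofReal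
  have hac : ρ ≪ volume := by
    refine Measure.AbsolutelyContinuous.mk fun A hA h0 => ?_
    have h1 := h (A.indicator 1) (measurable_one.indicator hA)
    have hm : AEMeasurable
        (fun u => A.indicator (1 : Ed d → ℝ≥0∞) (M u) * ENNReal.ofReal (exp (-r u))) P :=
      ((measurable_one.indicator hA).comp hM).aemeasurable.mul hre
    rw [lintegral_indicator_one hA, h0, nonpos_iff_eq_zero, lintegral_eq_zero_iff' hm] at h1
    rw [Measure.map_apply hM hA, ← compl_compl (M ⁻¹' A)]
    refine (mem_ae_iff.1 ?_ : P (((M ⁻¹' A)ᶜ)ᶜ) = 0)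
    filter_upwards [h1] with u hu hA'
    have hA'' : M u ∈ A := hA'
    simp only [indicator_of_mem hA'', Pi.one_apply, one_mul, Pi.zero_apply,
      ENNReal.ofReal_eq_zero] at hu
    exact absurd hu (not_le.2 (exp_pos _))
  set H : Ed d → ℝ≥0∞ := ρ.rnDeriv volume with hHdef
  have hH : Measurable H := Measure.measurable_rnDeriv _ _
  have hH1 : ∫⁻ u, H (M u) * ENNReal.ofReal (exp (-r u)) ∂P ≤ 1 := by
    refine (h H hH).trans_eq ?_
    have := lintegral_rnDeriv_mul hac (measurable_const (a := (1 : ℝ≥0∞)))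
    simpa using this
  set K : B → ℝ := fun u => (H (M u)).toReal * exp (-r u)
  have hK0 : ∀ u, 0 ≤ K u := fun u => mul_nonneg ENNReal.toReal_nonneg (exp_pos _).le
  have hKm : AEStronglyMeasurable K P :=
    ((hH.comp hM).ennreal_toReal.aemeasurable.mul hr.aemeasurable.neg.exp).aestronglyMeasurable
  have hae : ∀ᵐ u ∂P, H (M u) ≠ 0 ∧ H (M u) ≠ ∞ :=
    ae_of_ae_map hM.aemeasurable (ae_rnDeriv_ne hac)
  have hKle : ∫⁻ u, ENNReal.ofReal (K u) ∂P ≤ 1 := by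
    refine (lintegral_mono_ae ?_).trans hH1
    filter_upwards [hae] with u hu
    rw [ENNReal.ofReal_mul ENNReal.toReal_nonneg, ENNReal.ofReal_toReal hu.2]
  have hKi : Integrable K P :=
    (lintegral_ofReal_ne_top_iff_integrable hKm (ae_of_all _ hK0)).1
      (hKle.trans_lt ENNReal.one_lt_top).ne
  have hle : ∀ᵐ u ∂P, logDens ρ (M u) ≤ r u + K u - 1 := by
    filter_upwards [hae] with u hu
    have hpos : 0 < (H (M u)).toReal := ENNReal.toReal_pos hu.1 hu.2
    have := Real.log_le_sub_one_of_pos (mul_pos hpos (exp_pos (-r u)))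
    rw [Real.log_mul hpos.ne' (exp_pos _).ne', Real.log_exp] at this
    change Real.log (H (M u)).toReal ≤ r u + (H (M u)).toReal * exp (-r u) - 1
    linarith
  have hLm : Measurable fun u => logDens ρ (M u) := (measurable_logDens ρ).comp hM
  have hLm' : Measurable fun x => -logDens ρ x := (measurable_logDens ρ).neg
  rw [entropy_eq hac, lintegral_map (measurable_logDens ρ).ennreal_ofReal hM,
    lintegral_map hLm'.ennreal_ofReal hM]
  by_cases hneg : ∫⁻ u, ENNReal.ofReal (-logDens ρ (M u)) ∂P = ∞
  · rw [coe_sub_eq_bot hneg]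
    exact bot_le
  · have hbd : Integrable (fun u => r u + K u - 1) P := (hr.add hKi).sub (integrable_const _)
    have hpos : ∫⁻ u, ENNReal.ofReal (logDens ρ (M u)) ∂P ≠ ∞ := by
      refine ne_top_of_le_ne_top (lintegral_ofReal_ne_top hbd) (lintegral_mono_ae ?_)
      exact hle.mono fun u hu => ENNReal.ofReal_le_ofReal hu
    have hi := integrable_of_lintegral_ofReal hLm.aestronglyMeasurable hpos hneg
    rw [coe_lintegral_sub_eq_integral hi, EReal.coe_le_coe_iff]
    have hK1 : ∫ u, K u ∂P ≤ 1 := by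
      rw [integral_eq_lintegral_of_nonneg_ae (ae_of_all _ hK0) hKm]
      exact ENNReal.toReal_le_of_le_ofReal zero_le_one (by simpa using hKle)
    calc ∫ u, logDens ρ (M u) ∂P ≤ ∫ u, (r u + K u - 1) ∂P := integral_mono_ae hi hbd hle
      _ = ∫ u, r u ∂P + ∫ u, K u ∂P - 1 := by
        have hrK : Integrable (fun u => r u + K u) P := hr.add hKi
        rw [integral_sub hrK (integrable_const _), integral_add hr hKi]
        simp
      _ ≤ ∫ u, r u ∂P := by linarith

lemma lintegral_neg_logDens_ne_top {ρ : Measure (Ed d)} [IsProbabilityMeasure ρ]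
    (hρ : ρ ≪ volume) (h1 : FirstMoment ρ) : ∫⁻ x, ENNReal.ofReal (-logDens ρ x) ∂ρ ≠ ∞ := by
  set q : Ed d → ℝ := fun x => (1 + ‖x‖) ^ (-((d : ℝ) + 1))
  have hq0 : ∀ x, 0 < q x := fun x => by positivity
  have hq : Integrable q volume := by
    refine integrable_one_add_norm ?_
    simp
  have hqm : Measurable q := by fun_prop
  have hH := Measure.measurable_rnDeriv ρ volume
  have hle : ∀ᵐ x ∂ρ, ENNReal.ofReal (-logDens ρ x) ≤
      ENNReal.ofReal (((d : ℝ) + 1) * ‖x‖) +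
        ENNReal.ofReal (q x) * (ρ.rnDeriv volume x)⁻¹ := by
    filter_upwards [ae_rnDeriv_ne hρ] with x hx
    have hpos : 0 < (ρ.rnDeriv volume x).toReal := ENNReal.toReal_pos hx.1 hx.2
    set t := (ρ.rnDeriv volume x).toReal with ht
    have e : (ρ.rnDeriv volume x)⁻¹ = ENNReal.ofReal t⁻¹ := by
      rw [ENNReal.ofReal_inv_of_pos hpos, ht, ENNReal.ofReal_toReal hx.2]
    rw [e, ← ENNReal.ofReal_mul (hq0 x).le, ← ENNReal.ofReal_add (by positivity)
      (mul_nonneg (hq0 x).le (inv_nonneg.2 hpos.le))]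
    refine ENNReal.ofReal_le_ofReal ?_
    have h2 := Real.log_le_sub_one_of_pos (mul_pos (hq0 x) (inv_pos.2 hpos))
    rw [Real.log_mul (hq0 x).ne' (inv_pos.2 hpos).ne', Real.log_inv,
      Real.log_rpow (by positivity)] at h2
    have h3 : Real.log (1 + ‖x‖) ≤ ‖x‖ := by
      have := Real.log_le_sub_one_of_pos (show 0 < 1 + ‖x‖ by positivity)
      linarith
    have h4 : ((d : ℝ) + 1) * Real.log (1 + ‖x‖) ≤ ((d : ℝ) + 1) * ‖x‖ := by gcongr
    change -Real.log t ≤ _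
    linarith
  refine ne_top_of_le_ne_top ?_ (lintegral_mono_ae hle)
  have hm1 : Measurable fun x : Ed d => ENNReal.ofReal (((d : ℝ) + 1) * ‖x‖) := by fun_prop
  rw [lintegral_add_left hm1]
  refine ENNReal.add_ne_top.2 ⟨lintegral_ofReal_ne_top (Integrable.const_mul h1 _), ?_⟩
  have hm2 : Measurable fun x => ENNReal.ofReal (q x) * (ρ.rnDeriv volume x)⁻¹ :=
    hqm.ennreal_ofReal.mul hH.inv
  rw [← lintegral_rnDeriv_mul hρ hm2]
  refine ne_top_of_le_ne_top (lintegral_ofReal_ne_top hq) (lintegral_mono fun x => ?_)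
  calc ρ.rnDeriv volume x * (ENNReal.ofReal (q x) * (ρ.rnDeriv volume x)⁻¹)
      = ENNReal.ofReal (q x) * (ρ.rnDeriv volume x * (ρ.rnDeriv volume x)⁻¹) := by ring
    _ ≤ ENNReal.ofReal (q x) * 1 := by gcongr; exact ENNReal.mul_inv_le_one _
    _ = _ := mul_one _

/-- A probability measure with first moment and entropy `< ⊤` has finite entropy. -/
lemma integrable_logDens {ρ : Measure (Ed d)} [IsProbabilityMeasure ρ] (h1 : FirstMoment ρ)
    (h : entropy ρ < ⊤) : ρ ≪ volume ∧ Integrable (logDens ρ) ρ ∧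
      entropy ρ = ((∫ x, logDens ρ x ∂ρ : ℝ) : EReal) := by
  have hac : ρ ≪ volume := by
    by_contra hac
    rw [entropy, if_neg hac] at h
    exact lt_irrefl _ h
  have hneg := lintegral_neg_logDens_ne_top hac h1
  have hpos : ∫⁻ x, ENNReal.ofReal (logDens ρ x) ∂ρ ≠ ∞ := by
    intro hpos
    rw [entropy_eq hac, hpos, EReal.coe_ennreal_top] at h
    lift ∫⁻ x, ENNReal.ofReal (-logDens ρ x) ∂ρ to NNReal using hneg with b
    exact absurd h (by simp [sub_eq_add_neg])
  have hi := integrable_of_lintegral_ofReal (measurable_logDens ρ).aestronglyMeasurable hpos hneg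
  exact ⟨hac, hi, (entropy_eq hac).trans (coe_lintegral_sub_eq_integral hi)⟩

end EntropyTransport

namespace EntropyTransport

open Set ProbabilityTheory

/-! ### The maximal correlation functional -/

variable {d : ℕ}

lemma measurable_inner_prod : Measurable fun p : Ed d × Ed d => (⟪p.1, p.2⟫ : ℝ) :=
  (continuous_fst.inner continuous_snd).measurable

lemma integrable_inner_prod {ρ μ : Measure (Ed d)} [IsFiniteMeasure ρ] [IsFiniteMeasure μ]
    (hρ : FirstMoment ρ) (hμ : FirstMoment μ) :
    Integrable (fun p : Ed d × Ed d => (⟪p.1, p.2⟫ : ℝ)) (ρ.prod μ) :=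
  (Integrable.mul_prod hρ hμ).mono' measurable_inner_prod.aestronglyMeasurable
    (ae_of_all _ fun p => norm_inner_le_norm p.1 p.2)

lemma pairInt_eq_integral {γ : Measure (Ed d × Ed d)}
    (h : Integrable (fun p : Ed d × Ed d => (⟪p.1, p.2⟫ : ℝ)) γ) :
    pairInt γ = ((∫ p, (⟪p.1, p.2⟫ : ℝ) ∂γ : ℝ) : EReal) :=
  coe_lintegral_sub_eq_integral h

lemma bot_lt_maxCorr {ρ μ : Measure (Ed d)} [IsProbabilityMeasure ρ] [IsProbabilityMeasure μ]
    (hρ : FirstMoment ρ) (hμ : FirstMoment μ) : ⊥ < maxCorr ρ μ := by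
  have hmem : ρ.prod μ ∈ Couplings ρ μ :=
    ⟨inferInstance, Measure.fst_prod, Measure.snd_prod⟩
  refine lt_of_lt_of_le ?_ (le_iSup₂ (f := fun γ (_ : γ ∈ Couplings ρ μ) => pairInt γ) _ hmem)
  rw [pairInt_eq_integral (integrable_inner_prod hρ hμ)]
  exact EReal.bot_lt_coe _

lemma maxCorr_lt_top_of_ball {ρ μ : Measure (Ed d)} (hρ : ∀ᵐ x ∂ρ, ‖x‖ ≤ 1)
    (hμ : FirstMoment μ) : maxCorr ρ μ < ⊤ := by
  have hfin : ∫⁻ y, ENNReal.ofReal ‖y‖ ∂μ ≠ ∞ := lintegral_ofReal_ne_top hμ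
  refine lt_of_le_of_lt (b := ((∫⁻ y, ENNReal.ofReal ‖y‖ ∂μ : ℝ≥0∞) : EReal)) ?_ ?_
  · refine iSup₂_le fun γ hγ => ?_
    obtain ⟨_, h1, h2⟩ := hγ
    have hle : ∫⁻ p, ENNReal.ofReal (⟪p.1, p.2⟫ : ℝ) ∂γ ≤ ∫⁻ y, ENNReal.ofReal ‖y‖ ∂μ := by
      rw [← h2, Measure.snd, lintegral_map (by fun_prop) measurable_snd]
      refine lintegral_mono_ae ?_
      have : ∀ᵐ p ∂γ, ‖p.1‖ ≤ 1 := by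
        rw [← h1] at hρ
        exact ae_of_ae_map measurable_fst.aemeasurable hρ
      filter_upwards [this] with p hp
      refine ENNReal.ofReal_le_ofReal ((real_inner_le_norm _ _).trans ?_)
      exact mul_le_of_le_one_left (norm_nonneg _) hp
    refine le_trans (EReal.sub_le_sub (EReal.coe_ennreal_le_coe_ennreal_iff.2 hle)
      (EReal.coe_ennreal_nonneg _)) ?_
    simp
  · exact lt_top_iff_ne_top.2 (by simpa using hfin)

lemma firstMoment_fst_restrict {ρ μ : Measure (Ed d)} {γ : Measure (Ed d × Ed d)}
    (hγ : γ ∈ Couplings ρ μ) (hρ : FirstMoment ρ) (hμ : FirstMoment μ) (K : Set (Ed d × Ed d)) :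
    FirstMoment (γ.restrict K).fst ∧ FirstMoment (γ.restrict K).snd := by
  obtain ⟨_, h1, h2⟩ := hγ
  constructor
  · refine Integrable.mono_measure hρ ?_
    rw [← h1]
    exact Measure.map_mono Measure.restrict_le_self measurable_fst
  · refine Integrable.mono_measure hμ ?_
    rw [← h2]
    exact Measure.map_mono Measure.restrict_le_self measurable_snd

/-- Rearrange the part of a coupling in `Kᶜ` into a product. -/
def rearrange (γ : Measure (Ed d × Ed d)) (K : Set (Ed d × Ed d)) : Measure (Ed d × Ed d) :=
  γ.restrict K + (γ Kᶜ)⁻¹ • (γ.restrict Kᶜ).fst.prod (γ.restrict Kᶜ).snd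

lemma rearrange_mem {ρ μ : Measure (Ed d)} {γ : Measure (Ed d × Ed d)}
    (hγ : γ ∈ Couplings ρ μ) {K : Set (Ed d × Ed d)} (hK : MeasurableSet K) :
    rearrange γ K ∈ Couplings ρ μ := by
  obtain ⟨hp, h1, h2⟩ := hγ
  have hm : (γ.restrict Kᶜ) univ = γ Kᶜ := by simp
  have hcancel : ∀ ν : Measure (Ed d), ν univ = γ Kᶜ → ((γ Kᶜ)⁻¹ * γ Kᶜ) • ν = ν := by
    intro ν hν
    by_cases h0 : γ Kᶜ = 0
    · rw [Measure.measure_univ_eq_zero.1 (hν.trans h0), smul_zero]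
    · rw [ENNReal.inv_mul_cancel h0 (measure_ne_top γ _), one_smul]
  have hf : (rearrange γ K).fst = ρ := by
    rw [← h1, rearrange, Measure.fst, Measure.map_add _ _ measurable_fst, Measure.map_smul,
      Measure.map_fst_prod, Measure.snd_univ, hm, smul_smul,
      hcancel _ (by rw [Measure.fst_univ, hm]), Measure.fst,
      ← Measure.map_add _ _ measurable_fst, Measure.restrict_add_restrict_compl hK, Measure.fst]
  have hs : (rearrange γ K).snd = μ := by
    rw [← h2, rearrange, Measure.snd, Measure.map_add _ _ measurable_snd, Measure.map_smul,
      Measure.map_snd_prod, Measure.fst_univ, hm, smul_smul,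
      hcancel _ (by rw [Measure.snd_univ, hm]), Measure.snd,
      ← Measure.map_add _ _ measurable_snd, Measure.restrict_add_restrict_compl hK, Measure.snd]
  refine ⟨⟨?_⟩, hf, hs⟩
  rw [← Measure.fst_univ, hf, ← h1, Measure.fst_univ, measure_univ]

/-- If the maximal correlation is not `+∞`, the positive part of `⟨x, y⟩` is integrable for every
coupling. -/
lemma lintegral_inner_ne_top {ρ μ : Measure (Ed d)} (hρ : FirstMoment ρ) (hμ : FirstMoment μ)
    (h : maxCorr ρ μ < ⊤) {γ : Measure (Ed d × Ed d)} (hγ : γ ∈ Couplings ρ μ) :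
    ∫⁻ p, ENNReal.ofReal (⟪p.1, p.2⟫ : ℝ) ∂γ ≠ ∞ := by
  intro htop
  have hp := hγ.1
  set K : Set (Ed d × Ed d) := {p | 0 < (⟪p.1, p.2⟫ : ℝ)}
  have hK : MeasurableSet K := measurableSet_lt measurable_const measurable_inner_prod
  have hmem := rearrange_mem hγ hK
  have hmom := firstMoment_fst_restrict hγ hρ hμ Kᶜ
  have hm1 : Measurable fun p : Ed d × Ed d => ENNReal.ofReal (⟪p.1, p.2⟫ : ℝ) :=
    measurable_inner_prod.ennreal_ofReal
  have hm2 : Measurable fun p : Ed d × Ed d => ENNReal.ofReal (-(⟪p.1, p.2⟫ : ℝ)) :=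
    measurable_inner_prod.neg.ennreal_ofReal
  have hpos : ∫⁻ p, ENNReal.ofReal (⟪p.1, p.2⟫ : ℝ) ∂(rearrange γ K) = ∞ := by
    have h0 : ∫⁻ p in Kᶜ, ENNReal.ofReal (⟪p.1, p.2⟫ : ℝ) ∂γ = 0 := by
      rw [setLIntegral_congr_fun (g := fun _ => 0) hK.compl fun p hp => ?_, lintegral_zero]
      exact ENNReal.ofReal_of_nonpos (not_lt.1 hp)
    have h1 := lintegral_add_compl (μ := γ)
      (fun p : Ed d × Ed d => ENNReal.ofReal (⟪p.1, p.2⟫ : ℝ)) hK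
    rw [h0, add_zero, htop] at h1
    rw [rearrange, lintegral_add_measure, h1, top_add]
  have hneg : ∫⁻ p, ENNReal.ofReal (-(⟪p.1, p.2⟫ : ℝ)) ∂(rearrange γ K) ≠ ∞ := by
    have h0 : ∫⁻ p in K, ENNReal.ofReal (-(⟪p.1, p.2⟫ : ℝ)) ∂γ = 0 := by
      rw [setLIntegral_congr_fun (g := fun _ => 0) hK fun p hp => ?_, lintegral_zero]
      exact ENNReal.ofReal_of_nonpos (neg_nonpos.2 (le_of_lt hp))
    rw [rearrange, lintegral_add_measure, h0, zero_add, lintegral_smul_measure]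
    by_cases hc : γ Kᶜ = 0
    · rw [Measure.restrict_eq_zero.2 hc]
      simp
    · refine ENNReal.mul_ne_top (ENNReal.inv_ne_top.2 hc) ?_
      exact lintegral_ofReal_ne_top (integrable_inner_prod hmom.1 hmom.2).neg
  have hle : pairInt (rearrange γ K) ≤ maxCorr ρ μ :=
    le_iSup₂ (f := fun γ (_ : γ ∈ Couplings ρ μ) => pairInt γ) _ hmem
  refine absurd (lt_of_le_of_lt hle h) ?_
  rw [pairInt, hpos]
  lift ∫⁻ p, ENNReal.ofReal (-(⟪p.1, p.2⟫ : ℝ)) ∂(rearrange γ K) to NNReal using hneg with b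
  simp [sub_eq_add_neg]

/-- A coupling of the law of `W` with `μ` can be lifted to the probability space of `W`. -/
lemma exists_lift {B : Type} [MeasurableSpace B] {P : Measure B} [IsProbabilityMeasure P]
    {W : B → Ed d} (hW : Measurable W) {μ : Measure (Ed d)} {γ : Measure (Ed d × Ed d)}
    (hγ : γ ∈ Couplings (P.map W) μ) : ∃ L : Measure (B × Ed d), IsProbabilityMeasure L ∧
      L.fst = P ∧ L.snd = μ ∧ L.map (fun p => (W p.1, p.2)) = γ := by
  obtain ⟨_, h1, h2⟩ := hγ
  set κ := γ.condKernel.comap W hW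
  have hWm : Measurable fun p : B × Ed d => (W p.1, p.2) :=
    (hW.comp measurable_fst).prodMk measurable_snd
  have hmap : (P ⊗ₘ κ).map (fun p => (W p.1, p.2)) = γ := by
    refine Measure.ext_of_lintegral _ fun φ hφ => ?_
    have hφW : Measurable fun p : B × Ed d => φ (W p.1, p.2) := hφ.comp hWm
    rw [lintegral_map hφ hWm, Measure.lintegral_compProd hφW]
    conv_rhs => rw [← Measure.disintegrate γ γ.condKernel, Measure.lintegral_compProd hφ, h1,
      lintegral_map hφ.lintegral_kernel_prod_right' hW]
    rfl
  refine ⟨P ⊗ₘ κ, inferInstance, Measure.fst_compProd _ _, ?_, hmap⟩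
  rw [← h2, ← hmap, Measure.snd, Measure.snd, Measure.map_map measurable_snd hWm]
  rfl

lemma mem_couplings_map {B : Type} [MeasurableSpace B] {P : Measure B}
    {X : B → Ed d} (hX : Measurable X) {μ : Measure (Ed d)} {L : Measure (B × Ed d)}
    [IsProbabilityMeasure L] (h1 : L.fst = P) (h2 : L.snd = μ) :
    L.map (fun p => (X p.1, p.2)) ∈ Couplings (P.map X) μ := by
  have hXm : Measurable fun p : B × Ed d => (X p.1, p.2) :=
    (hX.comp measurable_fst).prodMk measurable_snd
  refine ⟨Measure.isProbabilityMeasure_map hXm.aemeasurable, ?_, ?_⟩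
  · rw [← h1, Measure.fst, Measure.fst, Measure.map_map measurable_fst hXm,
      Measure.map_map hX measurable_fst]
    rfl
  · rw [← h2, Measure.snd, Measure.snd, Measure.map_map measurable_snd hXm]
    rfl

/-- Convexity of the maximal correlation along couplings. -/
lemma maxCorr_combo_le {B : Type} [MeasurableSpace B] {P : Measure B} [IsProbabilityMeasure P]
    {X Y : B → Ed d} (hX : Measurable X) (hY : Measurable Y) {μ : Measure (Ed d)}
    (hX1 : FirstMoment (P.map X)) (hY1 : FirstMoment (P.map Y)) (hμ : FirstMoment μ)
    {a b S T : ℝ} (ha : 0 < a) (hb : 0 < b) (hS : maxCorr (P.map X) μ = S)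
    (hT : maxCorr (P.map Y) μ = T) :
    maxCorr (P.map fun u => a • X u + b • Y u) μ ≤ ((a * S + b * T : ℝ) : EReal) := by
  have hW : Measurable fun u => a • X u + b • Y u := (hX.const_smul a).add (hY.const_smul b)
  refine iSup₂_le fun γ hγ => ?_
  obtain ⟨L, hL, h1, h2, hLγ⟩ := exists_lift hW hγ
  have main : ∀ {Z : B → Ed d} (_ : Measurable Z) (U : ℝ) (_ : FirstMoment (P.map Z))
      (_ : maxCorr (P.map Z) μ = U),
      (∫⁻ p, ENNReal.ofReal (⟪Z p.1, p.2⟫ : ℝ) ∂L ≠ ∞) ∧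
      (Integrable (fun p : B × Ed d => (⟪Z p.1, p.2⟫ : ℝ)) L →
        ∫ p, (⟪Z p.1, p.2⟫ : ℝ) ∂L ≤ U) := by
    intro Z hZ U hZ1 hU
    have hZm : Measurable fun p : B × Ed d => (Z p.1, p.2) :=
      (hZ.comp measurable_fst).prodMk measurable_snd
    have hmem := mem_couplings_map hZ h1 h2
    constructor
    · have := lintegral_inner_ne_top hZ1 hμ (by rw [hU]; exact EReal.coe_lt_top _) hmem
      rwa [lintegral_map measurable_inner_prod.ennreal_ofReal hZm] at this
    · intro hi
      have hi' : Integrable (fun p : Ed d × Ed d => (⟪p.1, p.2⟫ : ℝ))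
          (L.map fun p => (Z p.1, p.2)) :=
        (integrable_map_measure measurable_inner_prod.aestronglyMeasurable hZm.aemeasurable).2 hi
      have hle : pairInt (L.map fun p => (Z p.1, p.2)) ≤ maxCorr (P.map Z) μ :=
        le_iSup₂ (f := fun γ (_ : γ ∈ Couplings (P.map Z) μ) => pairInt γ) _ hmem
      rw [pairInt_eq_integral hi', hU, EReal.coe_le_coe_iff,
        integral_map hZm.aemeasurable measurable_inner_prod.aestronglyMeasurable] at hle
      exact hle
  obtain ⟨hXp, hXi⟩ := main hX S hX1 hS
  obtain ⟨hYp, hYi⟩ := main hY T hY1 hT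
  have hinner : ∀ {Z : B → Ed d}, Measurable Z →
      Measurable fun p : B × Ed d => (⟪Z p.1, p.2⟫ : ℝ) := fun hZ =>
    measurable_inner_prod.comp ((hZ.comp measurable_fst).prodMk measurable_snd)
  have hWm : Measurable fun p : B × Ed d => (a • X p.1 + b • Y p.1, p.2) :=
    (hW.comp measurable_fst).prodMk measurable_snd
  have hsplit : ∀ p : B × Ed d, (⟪a • X p.1 + b • Y p.1, p.2⟫ : ℝ) =
      a * ⟪X p.1, p.2⟫ + b * ⟪Y p.1, p.2⟫ := fun p => by
    rw [inner_add_left, real_inner_smul_left, real_inner_smul_left]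
  by_cases hneg : ∫⁻ p, ENNReal.ofReal (-(⟪p.1, p.2⟫ : ℝ)) ∂γ = ∞
  · rw [pairInt, coe_sub_eq_bot hneg]
    exact bot_le
  have hm2 : Measurable fun p : Ed d × Ed d => ENNReal.ofReal (-(⟪p.1, p.2⟫ : ℝ)) :=
    measurable_inner_prod.neg.ennreal_ofReal
  have hneg' : ∫⁻ p, ENNReal.ofReal (-(a * ⟪X p.1, p.2⟫ + b * ⟪Y p.1, p.2⟫)) ∂L ≠ ∞ := by
    rw [← hLγ, lintegral_map hm2 hWm] at hneg
    simp_rw [← hsplit]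
    exact hneg
  have bound : ∀ {c e : ℝ} (_ : 0 < c) (_ : 0 < e) {p q : B × Ed d → ℝ} (_ : Measurable p)
      (_ : Measurable q), (∫⁻ z, ENNReal.ofReal (p z) ∂L ≠ ∞) →
      (∫⁻ z, ENNReal.ofReal (q z) ∂L ≠ ∞) →
      (∫⁻ z, ENNReal.ofReal (-(c * p z + e * q z)) ∂L ≠ ∞) → Integrable p L := by
    intro c e hc he p q hp hq hp1 hq1 hpq
    refine integrable_of_lintegral_ofReal hp.aestronglyMeasurable hp1 ?_
    have hle : ∀ z, ENNReal.ofReal (-p z) ≤ ENNReal.ofReal c⁻¹ *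
        (ENNReal.ofReal (-(c * p z + e * q z)) + ENNReal.ofReal e * ENNReal.ofReal (q z)) := by
      intro z
      rw [← ENNReal.ofReal_mul he.le]
      calc ENNReal.ofReal (-p z)
          = ENNReal.ofReal (c⁻¹ * (-(c * p z + e * q z) + e * q z)) := by
            congr 1
            field_simp
            ring
        _ = ENNReal.ofReal c⁻¹ * ENNReal.ofReal (-(c * p z + e * q z) + e * q z) :=
            ENNReal.ofReal_mul (inv_nonneg.2 hc.le)
        _ ≤ _ := by
            gcongr
            exact ENNReal.ofReal_add_le
    refine ne_top_of_le_ne_top ?_ (lintegral_mono hle)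
    have hmpq : Measurable fun z => ENNReal.ofReal (-(c * p z + e * q z)) :=
      ((hp.const_mul c).add (hq.const_mul e)).neg.ennreal_ofReal
    rw [lintegral_const_mul' _ _ ENNReal.ofReal_ne_top, lintegral_add_left hmpq,
      lintegral_const_mul' _ _ ENNReal.ofReal_ne_top]
    exact ENNReal.mul_ne_top ENNReal.ofReal_ne_top
      (ENNReal.add_ne_top.2 ⟨hpq, ENNReal.mul_ne_top ENNReal.ofReal_ne_top hq1⟩)
  have hXint := bound ha hb (hinner hX) (hinner hY) hXp hYp hneg'
  have hYint := bound hb ha (hinner hY) (hinner hX) hYp hXp (by simpa only [add_comm] using hneg')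
  have hWint : Integrable (fun p : B × Ed d => a * (⟪X p.1, p.2⟫ : ℝ) + b * ⟪Y p.1, p.2⟫) L :=
    (hXint.const_mul a).add (hYint.const_mul b)
  have hγint : Integrable (fun p : Ed d × Ed d => (⟪p.1, p.2⟫ : ℝ)) γ := by
    rw [← hLγ, integrable_map_measure measurable_inner_prod.aestronglyMeasurable hWm.aemeasurable]
    exact hWint.congr (ae_of_all _ fun p => (hsplit p).symm)
  rw [pairInt_eq_integral hγint, EReal.coe_le_coe_iff, ← hLγ,
    integral_map hWm.aemeasurable measurable_inner_prod.aestronglyMeasurable]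
  simp_rw [hsplit]
  rw [integral_add (hXint.const_mul a) (hYint.const_mul b), integral_const_mul,
    integral_const_mul]
  have := hXi hXint
  have := hYi hYint
  gcongr

end EntropyTransport

namespace EntropyTransport

open Set ProbabilityTheory

/-! ### The variational inequality -/

variable {d : ℕ}

/-- `ρ` is an absolutely continuous minimizer of `E + T(·, μ)` with finite entropy, and the
minimal value is `m`. -/
structure IsMinimizer (μ : Measure (Ed d)) (m : ℝ) (ρ : Measure (Ed d)) : Prop where
  prob : IsProbabilityMeasure ρ
  moment : FirstMoment ρ
  ac : ρ ≪ volume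
  integrable : Integrable (logDens ρ) ρ
  maxCorr_eq : maxCorr ρ μ = ((m - ∫ x, logDens ρ x ∂ρ : ℝ) : EReal)
  le : ∀ ρ' : Measure (Ed d), IsProbabilityMeasure ρ' → FirstMoment ρ' →
    (m : EReal) ≤ entropy ρ' + maxCorr ρ' μ

lemma exists_competitor {μ : Measure (Ed d)} (hμ : FirstMoment μ) : ∃ ρ : Measure (Ed d),
    IsProbabilityMeasure ρ ∧ FirstMoment ρ ∧ entropy ρ + maxCorr ρ μ < ⊤ := by
  set K : Set (Ed d) := Metric.closedBall 0 1
  have hK : MeasurableSet K := Metric.isClosed_closedBall.measurableSet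
  have hK0 : volume K ≠ 0 := (Metric.measure_closedBall_pos _ _ one_pos).ne'
  have hKt : volume K ≠ ∞ := measure_closedBall_lt_top.ne
  have hprob : IsProbabilityMeasure (volume[|K]) := cond_isProbabilityMeasure_of_finite hK0 hKt
  have hV : 0 < (volume K).toReal := ENNReal.toReal_pos hK0 hKt
  have hball : ∀ᵐ x ∂(volume[|K]), ‖x‖ ≤ 1 := by
    filter_upwards [ae_cond_mem hK] with x hx
    simpa [K] using hx
  have hent : entropy ((volume[|K]).map id) ≤ _ := entropy_map_le measurable_id
    (integrable_const (-Real.log (volume K).toReal)) fun φ hφ => by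
      simp only [neg_neg, id]
      rw [Real.exp_log hV, lintegral_mul_const _ hφ, ENNReal.ofReal_toReal hKt, ProbabilityTheory.cond,
        lintegral_smul_measure, smul_eq_mul, mul_comm _ (volume K), ← mul_assoc,
        ENNReal.mul_inv_cancel hK0 hKt, one_mul]
      exact setLIntegral_le_lintegral _ _
  rw [Measure.map_id] at hent
  refine ⟨volume[|K], hprob, ?_, ?_⟩
  · exact (integrable_const (1 : ℝ)).mono' continuous_norm.aestronglyMeasurable
      (by simpa using hball)
  · exact EReal.add_lt_top (hent.trans_lt (EReal.coe_lt_top _)).ne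
      (maxCorr_lt_top_of_ball hball hμ).ne

lemma exists_isMinimizer {μ : Measure (Ed d)} [IsProbabilityMeasure μ] (hμ : FirstMoment μ)
    {ρ : Measure (Ed d)} [hρ : IsProbabilityMeasure ρ] (h1 : FirstMoment ρ)
    (hmin : ∀ ρ' : Measure (Ed d), IsProbabilityMeasure ρ' → FirstMoment ρ' →
      entropy ρ + maxCorr ρ μ ≤ entropy ρ' + maxCorr ρ' μ) :
    ∃ m : ℝ, entropy ρ + maxCorr ρ μ = m ∧ IsMinimizer μ m ρ := by
  obtain ⟨ρ', hp', h1', hlt⟩ := exists_competitor hμ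
  have hJ := (hmin ρ' hp' h1').trans_lt hlt
  have hbot := bot_lt_maxCorr h1 hμ
  have hent : entropy ρ < ⊤ := by
    refine lt_top_iff_ne_top.2 fun h => ?_
    rw [h, EReal.top_add_of_ne_bot hbot.ne'] at hJ
    exact lt_irrefl _ hJ
  obtain ⟨hac, hi, he⟩ := integrable_logDens h1 hent
  have hT : maxCorr ρ μ ≠ ⊤ := by
    intro h
    rw [h, he, EReal.coe_add_top] at hJ
    exact lt_irrefl _ hJ
  lift maxCorr ρ μ to ℝ using ⟨hT, hbot.ne'⟩ with T hTdef
  refine ⟨∫ x, logDens ρ x ∂ρ + T, by rw [he, EReal.coe_add], hρ, h1, hac, hi, ?_, ?_⟩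
  · rw [← hTdef]
    congr 1
    ring
  · intro ρ' hp' h1'
    have := hmin ρ' hp' h1'
    rwa [he, ← EReal.coe_add] at this

lemma firstMoment_combo {B : Type} [MeasurableSpace B] {P : Measure B} {X Y : B → Ed d}
    (hX : Measurable X) (hY : Measurable Y) (hX1 : FirstMoment (P.map X))
    (hY1 : FirstMoment (P.map Y)) (a b : ℝ) :
    FirstMoment (P.map fun u => a • X u + b • Y u) := by
  have hn : ∀ {Z : B → Ed d}, Measurable Z →
      (FirstMoment (P.map Z) ↔ Integrable Z P) := fun hZ => by
    rw [FirstMoment, integrable_map_measure continuous_norm.aestronglyMeasurable hZ.aemeasurable]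
    exact integrable_norm_iff hZ.aestronglyMeasurable
  rw [hn hX] at hX1
  rw [hn hY] at hY1
  have hM : Measurable fun u => a • X u + b • Y u := (hX.const_smul a).add (hY.const_smul b)
  rw [hn hM]
  exact (hX1.smul a).add (hY1.smul b)

/-- First variation: any lower bound `exp r` for the Jacobian of an interpolation between
minimizers dominates the interpolated entropies on average. -/
lemma IsMinimizer.le_integral {μ : Measure (Ed d)} (hμ : FirstMoment μ) {m : ℝ}
    {B : Type} [MeasurableSpace B] {P : Measure B} [IsProbabilityMeasure P]
    {X Y : B → Ed d} (hX : Measurable X) (hY : Measurable Y)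
    (hρX : IsMinimizer μ m (P.map X)) (hρY : IsMinimizer μ m (P.map Y))
    {a b : ℝ} (ha : 0 < a) (hb : 0 < b) (hab : a + b = 1) {r : B → ℝ} (hr : Integrable r P)
    (h : ∀ φ : Ed d → ℝ≥0∞, Measurable φ →
      ∫⁻ u, φ (a • X u + b • Y u) * ENNReal.ofReal (exp (-r u)) ∂P ≤ ∫⁻ x, φ x) :
    a * ∫ u, logDens (P.map X) (X u) ∂P + b * ∫ u, logDens (P.map Y) (Y u) ∂P ≤
      ∫ u, r u ∂P := by
  have hM : Measurable fun u => a • X u + b • Y u := (hX.const_smul a).add (hY.const_smul b)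
  have h1 := entropy_map_le hM hr h
  have h2 := maxCorr_combo_le hX hY hρX.moment hρY.moment hμ ha hb hρX.maxCorr_eq hρY.maxCorr_eq
  have h3 := hρX.le _ (Measure.isProbabilityMeasure_map hM.aemeasurable)
    (firstMoment_combo hX hY hρX.moment hρY.moment a b)
  have h4 := h3.trans (add_le_add h1 h2)
  rw [← EReal.coe_add, EReal.coe_le_coe_iff,
    integral_map hX.aemeasurable (measurable_logDens _).aestronglyMeasurable,
    integral_map hY.aemeasurable (measurable_logDens _).aestronglyMeasurable] at h4
  have : m = a * m + b * m := by rw [← add_mul, hab, one_mul]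
  linarith

end EntropyTransport

namespace EntropyTransport

open Set ProbabilityTheory

/-! ### Interpolants of a minimizer do not charge null sets of the minimizer -/

variable {d : ℕ}

lemma lintegral_exp_neg_logDens_le {ρ : Measure (Ed d)} [SigmaFinite ρ] (hρ : ρ ≪ volume)
    {φ : Ed d → ℝ≥0∞} (hφ : Measurable φ) :
    ∫⁻ x, φ x * ENNReal.ofReal (exp (-logDens ρ x)) ∂ρ ≤ ∫⁻ x, φ x := by
  have hl := measurable_logDens ρ
  have hm : Measurable fun x => φ x * ENNReal.ofReal (exp (-logDens ρ x)) := by fun_prop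
  rw [← lintegral_rnDeriv_mul hρ hm]
  refine lintegral_mono_ae ?_
  filter_upwards [Measure.rnDeriv_lt_top ρ volume] with x hx
  rcases eq_or_ne (ρ.rnDeriv volume x) 0 with h0 | h0
  · simp [h0]
  · have hpos : 0 < (ρ.rnDeriv volume x).toReal := ENNReal.toReal_pos h0 hx.ne
    rw [logDens, Real.exp_neg, Real.exp_log hpos, ENNReal.ofReal_inv_of_pos hpos,
      ENNReal.ofReal_toReal hx.ne, mul_comm (φ x), ← mul_assoc, ENNReal.mul_inv_cancel h0 hx.ne,
      one_mul]

lemma lintegral_comp_smul_add {a : ℝ} (ha : 0 < a) (c : Ed d) {φ : Ed d → ℝ≥0∞}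
    (hφ : Measurable φ) :
    ∫⁻ x, φ (a • x + c) * ENNReal.ofReal (a ^ d) = ∫⁻ x, φ x := by
  have hm : Measurable fun x : Ed d => φ (a • x + c) := by fun_prop
  have hs : ∫⁻ x, φ (x + c) ∂(volume.map (a • · : Ed d → Ed d)) =
      ∫⁻ x, φ (a • x + c) := lintegral_map (by fun_prop) (by fun_prop)
  rw [lintegral_mul_const _ hm, ← hs, Measure.map_addHaar_smul volume ha.ne',
    lintegral_smul_measure, lintegral_add_right_eq_self φ, smul_eq_mul, finrank_euclideanSpace,
    Fintype.card_fin, abs_of_pos (by positivity), mul_right_comm,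
    ← ENNReal.ofReal_mul (by positivity), inv_mul_cancel₀ (by positivity), ENNReal.ofReal_one,
    one_mul]

lemma lintegral_prod_interpolation_le {ρ : Measure (Ed d)} [IsProbabilityMeasure ρ]
    (hρ : ρ ≪ volume) {a : ℝ} (ha : 0 < a) (b : ℝ) {φ : Ed d → ℝ≥0∞} (hφ : Measurable φ) :
    ∫⁻ p, φ (a • p.1 + b • p.2) * ENNReal.ofReal (a ^ d * exp (-logDens ρ p.1)) ∂(ρ.prod ρ) ≤
      ∫⁻ x, φ x := by
  have hl := measurable_logDens ρ
  rw [lintegral_prod_symm _ (by fun_prop)]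
  calc ∫⁻ y, (∫⁻ x, φ (a • x + b • y) * ENNReal.ofReal (a ^ d * exp (-logDens ρ x)) ∂ρ) ∂ρ
      ≤ ∫⁻ _, (∫⁻ x, φ x) ∂ρ := by
        refine lintegral_mono fun y => ?_
        rw [← lintegral_comp_smul_add ha (b • y) hφ]
        refine le_trans (le_of_eq ?_) (lintegral_exp_neg_logDens_le hρ (by fun_prop))
        refine lintegral_congr fun x => ?_
        rw [ENNReal.ofReal_mul (by positivity), mul_assoc]
    _ = ∫⁻ x, φ x := by simp

/-- A random choice between the diagonal and the independent coupling. -/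
def mixture {E : Type} [MeasurableSpace E] (Q : Measure E) (θ : ℝ) : Measure (Bool × E) :=
  ENNReal.ofReal (1 - θ) • Q.map (Prod.mk true) + ENNReal.ofReal θ • Q.map (Prod.mk false)

section mixture

variable {E : Type} [MeasurableSpace E] {Q : Measure E} {θ : ℝ}

lemma ofReal_one_sub_add (hθ : θ ∈ Ioo (0 : ℝ) 1) :
    ENNReal.ofReal (1 - θ) + ENNReal.ofReal θ = 1 := by
  rw [← ENNReal.ofReal_add (by linarith [hθ.2]) hθ.1.le, sub_add_cancel, ENNReal.ofReal_one]

lemma mixture_map {F : Type} [MeasurableSpace F] {X : Bool × E → F} (hX : Measurable X) :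
    (mixture Q θ).map X = ENNReal.ofReal (1 - θ) • Q.map (fun p => X (true, p)) +
      ENNReal.ofReal θ • Q.map (fun p => X (false, p)) := by
  rw [mixture, Measure.map_add _ _ hX, Measure.map_smul, Measure.map_smul,
    Measure.map_map hX (by fun_prop), Measure.map_map hX (by fun_prop)]
  rfl

lemma isProbabilityMeasure_mixture [IsProbabilityMeasure Q] (hθ : θ ∈ Ioo (0 : ℝ) 1) :
    IsProbabilityMeasure (mixture Q θ) := by
  refine ⟨?_⟩
  rw [mixture, Measure.add_apply, Measure.smul_apply, Measure.smul_apply,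
    Measure.map_apply (by fun_prop) MeasurableSet.univ,
    Measure.map_apply (by fun_prop) MeasurableSet.univ]
  simp [ofReal_one_sub_add hθ]

lemma lintegral_mixture {φ : Bool × E → ℝ≥0∞} (hφ : Measurable φ) :
    ∫⁻ u, φ u ∂(mixture Q θ) = ENNReal.ofReal (1 - θ) * ∫⁻ p, φ (true, p) ∂Q +
      ENNReal.ofReal θ * ∫⁻ p, φ (false, p) ∂Q := by
  rw [mixture, lintegral_add_measure, lintegral_smul_measure, lintegral_smul_measure,
    lintegral_map hφ (by fun_prop), lintegral_map hφ (by fun_prop), smul_eq_mul, smul_eq_mul]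

lemma integral_mixture (hθ : θ ∈ Ioo (0 : ℝ) 1) {r : Bool × E → ℝ} (hr : Measurable r)
    (h1 : Integrable (fun p => r (true, p)) Q) (h2 : Integrable (fun p => r (false, p)) Q) :
    Integrable r (mixture Q θ) ∧ ∫ u, r u ∂(mixture Q θ) =
      (1 - θ) * ∫ p, r (true, p) ∂Q + θ * ∫ p, r (false, p) ∂Q := by
  have i1 : Integrable r (ENNReal.ofReal (1 - θ) • Q.map (Prod.mk true)) :=
    ((integrable_map_measure hr.aestronglyMeasurable (by fun_prop)).2 h1).smul_measure
      ENNReal.ofReal_ne_top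
  have i2 : Integrable r (ENNReal.ofReal θ • Q.map (Prod.mk false)) :=
    ((integrable_map_measure hr.aestronglyMeasurable (by fun_prop)).2 h2).smul_measure
      ENNReal.ofReal_ne_top
  refine ⟨i1.add_measure i2, ?_⟩
  rw [mixture, integral_add_measure i1 i2, integral_smul_measure, integral_smul_measure,
    integral_map (by fun_prop) hr.aestronglyMeasurable,
    integral_map (by fun_prop) hr.aestronglyMeasurable,
    ENNReal.toReal_ofReal (by linarith [hθ.2]), ENNReal.toReal_ofReal hθ.1.le, smul_eq_mul,
    smul_eq_mul]

end mixture

open Classical in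
lemma IsMinimizer.entropy_gain_le {μ : Measure (Ed d)} [IsProbabilityMeasure μ]
    (hμ : FirstMoment μ) {m : ℝ} {ρ : Measure (Ed d)} (hρ : IsMinimizer μ m ρ) {N : Set (Ed d)}
    (hN : MeasurableSet N) (hN0 : ρ N = 0) {a b : ℝ} (ha : 0 < a) (hb : 0 < b) (hab : a + b = 1)
    {θ : ℝ} (hθ : θ ∈ Ioo (0 : ℝ) 1) :
    0 ≤ -(d * Real.log a) +
      (ρ.prod ρ).real {p | a • p.1 + b • p.2 ∈ N} * Real.log θ := by
  have := hρ.prob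
  have hac := hρ.ac
  have hl := measurable_logDens ρ
  set Q := ρ.prod ρ
  have : IsProbabilityMeasure (mixture Q θ) := isProbabilityMeasure_mixture hθ
  set A : Set (Ed d × Ed d) := {p | a • p.1 + b • p.2 ∈ N}
  have hA : MeasurableSet A := by
    have : Measurable fun p : Ed d × Ed d => a • p.1 + b • p.2 := by fun_prop
    exact this hN
  set X : Bool × (Ed d × Ed d) → Ed d := fun u => u.2.1
  set Y : Bool × (Ed d × Ed d) → Ed d := fun u => if u.1 = true then u.2.1 else u.2.2
  set r : Bool × (Ed d × Ed d) → ℝ := fun u => if u.1 = true then logDens ρ u.2.1 else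
    logDens ρ u.2.1 + (-(d * Real.log a) + A.indicator (fun _ => Real.log θ) u.2)
  have hb' : MeasurableSet {u : Bool × (Ed d × Ed d) | u.1 = true} :=
    measurable_fst (measurableSet_singleton true)
  have hX : Measurable X := by fun_prop
  have hY : Measurable Y := Measurable.ite hb' (by fun_prop) (by fun_prop)
  have hi : Measurable (A.indicator (fun _ => Real.log θ)) := measurable_const.indicator hA
  have hrm : Measurable r := Measurable.ite hb' (by fun_prop) (by fun_prop)
  have hfst : Q.map Prod.fst = ρ := by
    have := Measure.fst_prod (μ := ρ) (ν := ρ)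
    rwa [Measure.fst] at this
  have hsnd : Q.map Prod.snd = ρ := by
    have := Measure.snd_prod (μ := ρ) (ν := ρ)
    rwa [Measure.snd] at this
  have hXl : (mixture Q θ).map X = ρ := by
    rw [mixture_map hX]
    simp only [X]
    rw [hfst, ← add_smul, ofReal_one_sub_add hθ, one_smul]
  have hYl : (mixture Q θ).map Y = ρ := by
    rw [mixture_map hY]
    simp only [Y, if_true, Bool.false_eq_true, if_false]
    rw [hfst, hsnd, ← add_smul, ofReal_one_sub_add hθ, one_smul]
  have hlQ : Integrable (fun p : Ed d × Ed d => logDens ρ p.1) Q :=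
    hρ.integrable.comp_fst ρ
  have hlQi : ∫ p, logDens ρ p.1 ∂Q = ∫ x, logDens ρ x ∂ρ := by
    rw [← integral_map (φ := Prod.fst) measurable_fst.aemeasurable hl.aestronglyMeasurable, hfst]
  have hind : Integrable (A.indicator (fun _ => Real.log θ)) Q :=
    (integrable_const _).indicator hA
  have hc : Integrable (fun p => -(d * Real.log a) + A.indicator (fun _ => Real.log θ) p) Q :=
    (integrable_const _).add hind
  have hr2 : Integrable (fun p => logDens ρ p.1 +
      (-(d * Real.log a) + A.indicator (fun _ => Real.log θ) p)) Q :=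
    hlQ.add hc
  obtain ⟨hri, hrI⟩ := integral_mixture (Q := Q) hθ hrm (by simpa [r] using hlQ)
    (by simpa [r] using hr2)
  have hIf : ∫ p, r (false, p) ∂Q = ∫ x, logDens ρ x ∂ρ + (-(d * Real.log a) +
      Q.real A * Real.log θ) := by
    simp only [r, Bool.false_eq_true, if_false]
    rw [integral_add hlQ hc, integral_add (integrable_const _) hind,
      integral_indicator_const _ hA, hlQi]
    simp
  have hIt : ∫ p, r (true, p) ∂Q = ∫ x, logDens ρ x ∂ρ := by
    simpa [r] using hlQi
  have key := IsMinimizer.le_integral (μ := μ) (m := m) (P := mixture Q θ) hμ hX hY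
    (hXl.symm ▸ hρ) (hYl.symm ▸ hρ) ha hb hab hri ?_
  · have e1 : ∫ u, logDens ρ (X u) ∂(mixture Q θ) = ∫ x, logDens ρ x ∂ρ := by
      rw [← integral_map hX.aemeasurable hl.aestronglyMeasurable, hXl]
    have e2 : ∫ u, logDens ρ (Y u) ∂(mixture Q θ) = ∫ x, logDens ρ x ∂ρ := by
      rw [← integral_map hY.aemeasurable hl.aestronglyMeasurable, hYl]
    rw [hXl, hYl, e1, e2, hrI, hIf, hIt, ← add_mul, hab] at key
    have hθ0 := hθ.1
    have : 0 ≤ θ * (-(d * Real.log a) + Q.real A * Real.log θ) := by linarith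
    exact nonneg_of_mul_nonneg_right this hθ0
  · intro φ hφ
    set k : Ed d → ℝ≥0∞ := N.indicator (fun _ => ENNReal.ofReal θ⁻¹) + Nᶜ.indicator 1
    have hk : Measurable k :=
      (measurable_const.indicator hN).add (measurable_one.indicator hN.compl)
    have hM : Measurable fun u => φ (a • X u + b • Y u) * ENNReal.ofReal (exp (-r u)) := by
      fun_prop
    rw [lintegral_mixture hM]
    have ht : ∫⁻ p, φ (a • X (true, p) + b • Y (true, p)) *
        ENNReal.ofReal (exp (-r (true, p))) ∂Q ≤ ∫⁻ x, φ x * Nᶜ.indicator 1 x := by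
      simp only [X, Y, r, if_true, ← add_smul, hab, one_smul]
      refine le_trans (le_of_eq ?_) (lintegral_exp_neg_logDens_le hac
        (hφ.mul (measurable_one.indicator hN.compl)))
      have hm : Measurable fun x => φ x * ENNReal.ofReal (exp (-logDens ρ x)) := by fun_prop
      rw [← lintegral_map (g := Prod.fst) hm measurable_fst, hfst]
      refine lintegral_congr_ae ?_
      filter_upwards [measure_eq_zero_iff_ae_notMem.1 hN0] with x hx
      simp [hx]
    have hf : ∫⁻ p, φ (a • X (false, p) + b • Y (false, p)) *
        ENNReal.ofReal (exp (-r (false, p))) ∂Q ≤ ∫⁻ x, φ x * k x := by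
      simp only [X, Y, r, Bool.false_eq_true, if_false]
      refine le_trans (le_of_eq ?_) (lintegral_prod_interpolation_le hac ha b (hφ.mul hk))
      refine lintegral_congr fun p => ?_
      have hexp : exp (d * Real.log a) = a ^ d := by
        rw [mul_comm, Real.exp_mul, Real.exp_log ha, Real.rpow_natCast]
      by_cases hp : a • p.1 + b • p.2 ∈ N
      · have hpA : p ∈ A := hp
        simp only [k, Pi.add_apply, hp, hpA, indicator_of_mem, mem_compl_iff,
          not_true_eq_false, not_false_eq_true, indicator_of_notMem, add_zero]
        rw [mul_assoc, ← ENNReal.ofReal_mul (by have := hθ.1; positivity)]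
        congr 2
        rw [neg_add, neg_add, neg_neg, Real.exp_add, Real.exp_add, hexp, Real.exp_neg (Real.log θ),
          Real.exp_log hθ.1]
        ring
      · have hpA : p ∉ A := hp
        simp only [k, Pi.add_apply, hp, hpA, indicator_of_mem, mem_compl_iff,
          not_false_eq_true, indicator_of_notMem, add_zero, zero_add,
          Pi.one_apply, mul_one]
        congr 2
        rw [neg_add, neg_neg, Real.exp_add, hexp]
        ring
    refine (add_le_add (mul_le_mul_right ht _) (mul_le_mul_right hf _)).trans ?_
    have hm1 : Measurable fun x => φ x * Nᶜ.indicator 1 x :=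
      hφ.mul (measurable_one.indicator hN.compl)
    have hm2 : Measurable fun x => φ x * k x := hφ.mul hk
    rw [← lintegral_const_mul _ hm1, ← lintegral_const_mul _ hm2,
      ← lintegral_add_left (hm1.const_mul _)]
    refine lintegral_mono fun x => ?_
    by_cases hx : x ∈ N
    · simp only [k, Pi.add_apply, hx, indicator_of_mem, mem_compl_iff, not_true_eq_false,
        not_false_eq_true, indicator_of_notMem, add_zero, mul_zero, zero_add]
      rw [mul_left_comm, ← ENNReal.ofReal_mul hθ.1.le, mul_inv_cancel₀ hθ.1.ne', ENNReal.ofReal_one,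
        mul_one]
    · simp only [k, Pi.add_apply, hx, indicator_of_mem, mem_compl_iff,
        not_false_eq_true, indicator_of_notMem, zero_add, Pi.one_apply, mul_one]
      rw [← add_mul, ofReal_one_sub_add hθ, one_mul]

/-- Null sets of a minimizer are null sets of its self-interpolants. -/
lemma IsMinimizer.ae_interpolation_notMem {μ : Measure (Ed d)} [IsProbabilityMeasure μ]
    (hμ : FirstMoment μ) {m : ℝ} {ρ : Measure (Ed d)} (hρ : IsMinimizer μ m ρ) {N : Set (Ed d)}
    (hN : MeasurableSet N) (hN0 : ρ N = 0) {a b : ℝ} (ha : 0 < a) (hb : 0 < b)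
    (hab : a + b = 1) : ∀ᵐ p ∂(ρ.prod ρ), a • p.1 + b • p.2 ∉ N := by
  have := hρ.prob
  refine measure_eq_zero_iff_ae_notMem (s := {p : Ed d × Ed d | a • p.1 + b • p.2 ∈ N}) |>.1 ?_
  by_contra h
  set q := (ρ.prod ρ).real {p | a • p.1 + b • p.2 ∈ N} with hq
  have hq0 : 0 < q := ENNReal.toReal_pos h (measure_ne_top _ _)
  have hc : 0 ≤ -(d * Real.log a) := by
    have := Real.log_nonpos ha.le (by linarith)
    have : (0 : ℝ) ≤ d * (-Real.log a) := mul_nonneg (Nat.cast_nonneg _) (by linarith)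
    linarith
  set K := (-(d * Real.log a) + 1) / q with hK
  have hK0 : 0 < K := by positivity
  have hgain := hρ.entropy_gain_le hμ hN hN0 ha hb hab (θ := exp (-K))
    ⟨exp_pos _, by simpa using hK0⟩
  rw [← hq, Real.log_exp, mul_neg, hK, mul_div_cancel₀ _ hq0.ne'] at hgain
  linarith

end EntropyTransport

namespace EntropyTransport

open Set ProbabilityTheory

/-! ### Translates of one-dimensional laws -/

lemma volume_inter_Ioo_eq_zero {B : Set ℝ} {s t : ℝ} (hst : s < t)
    (h : ∀ᵐ a ∂unif, a * s + (1 - a) * t ∉ B) : volume (B ∩ Ioo s t) = 0 := by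
  rw [unif, ae_restrict_iff' measurableSet_Ioo] at h
  have h0 : volume {a : ℝ | ¬ (a ∈ Ioo (0 : ℝ) 1 → a * s + (1 - a) * t ∉ B)} = 0 := h
  have himg := addHaar_image_eq_zero_of_differentiableOn_of_addHaar_eq_zero volume
    (f := fun a : ℝ => a * s + (1 - a) * t) (by fun_prop) h0
  refine measure_mono_null ?_ himg
  rintro x ⟨hxB, hx⟩
  have hts : 0 < t - s := sub_pos.2 hst
  have he : (t - x) / (t - s) * s + (1 - (t - x) / (t - s)) * t = x := by
    field_simp
    ring
  refine ⟨(t - x) / (t - s), ?_, he⟩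
  simp only [mem_ofPred_eq, Classical.not_imp, not_not]
  refine ⟨⟨div_pos (by linarith [hx.2]) hts, ?_⟩, he.symm ▸ hxB⟩
  rw [div_lt_one hts]
  linarith [hx.1]

lemma ae_density_ne_zero_of_interpolation {f : ℝ → ℝ≥0∞} (hf : Measurable f) {S : ℝ → ℝ}
    (hS : Measurable S) (hSm : MonotoneOn S (Ioo 0 1)) (hlaw : unif.map S = volume.withDensity f)
    (h : ∀ a ∈ Ioo (0 : ℝ) 1, ∀ᵐ p ∂((volume.withDensity f).prod (volume.withDensity f)),
      a * p.1 + (1 - a) * p.2 ∉ {x | f x = 0})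
    {α β : ℝ} (hα : α ∈ Ioo (0 : ℝ) 1) (hβ : β ∈ Ioo (0 : ℝ) 1) :
    ∀ᵐ x ∂(volume.restrict (Ioo (S α) (S β))), f x ≠ 0 := by
  rcases le_or_gt (S β) (S α) with hle | hlt
  · simp [Ioo_eq_empty_of_le hle]
  set B : Set ℝ := {x | f x = 0}
  have hB : MeasurableSet B := hf (measurableSet_singleton 0)
  set ν := volume.withDensity f
  have : IsProbabilityMeasure ν := hlaw ▸ Measure.isProbabilityMeasure_map hS.aemeasurable
  have h1 : ∀ᵐ a ∂unif, ∀ᵐ p ∂(ν.prod ν), a * p.1 + (1 - a) * p.2 ∉ B :=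
    ae_unif_mem.mono h
  have hm : MeasurableSet {q : ℝ × ℝ × ℝ | q.1 * q.2.1 + (1 - q.1) * q.2.2 ∉ B} := by
    have : Measurable fun q : ℝ × ℝ × ℝ => q.1 * q.2.1 + (1 - q.1) * q.2.2 := by fun_prop
    exact this hB.compl
  have h2 : ∀ᵐ p ∂(ν.prod ν), ∀ᵐ a ∂unif, a * p.1 + (1 - a) * p.2 ∉ B :=
    (Measure.ae_ae_comm hm).1 h1
  have h3 : ∀ᵐ p ∂(unif.prod unif), ∀ᵐ a ∂unif, a * S p.1 + (1 - a) * S p.2 ∉ B := by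
    rw [← hlaw, Measure.map_prod_map _ _ hS hS] at h2
    exact ae_of_ae_map (f := Prod.map S S) (hS.prodMap hS).aemeasurable h2
  have hpos : (unif.prod unif) (Ioo 0 α ×ˢ Ioo β 1) ≠ 0 := by
    have e1 : Ioo 0 α ∩ Ioo (0 : ℝ) 1 = Ioo 0 α :=
      inter_eq_left.2 (Ioo_subset_Ioo_right hα.2.le)
    have e2 : Ioo β 1 ∩ Ioo (0 : ℝ) 1 = Ioo β 1 :=
      inter_eq_left.2 (Ioo_subset_Ioo_left hβ.1.le)
    rw [Measure.prod_prod, unif, Measure.restrict_apply measurableSet_Ioo,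
      Measure.restrict_apply measurableSet_Ioo, e1, e2, Real.volume_Ioo, Real.volume_Ioo]
    simp [hα.1, hβ.2]
  obtain ⟨⟨u, v⟩, ⟨hu, hv⟩, huv⟩ : ∃ p : ℝ × ℝ, p ∈ Ioo 0 α ×ˢ Ioo β 1 ∧
      ∀ᵐ a ∂unif, a * S p.1 + (1 - a) * S p.2 ∉ B := by
    by_contra! hcon
    exact hpos (measure_mono_null (fun p hp => hcon p hp) h3)
  have hu1 : S u ≤ S α := hSm ⟨hu.1, hu.2.trans hα.2⟩ hα hu.2.le
  have hv1 : S β ≤ S v := hSm hβ ⟨hβ.1.trans hv.1, hv.2⟩ hv.1.le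
  have hnull := volume_inter_Ioo_eq_zero (hu1.trans_lt (hlt.trans_le hv1)) huv
  rw [ae_restrict_iff' measurableSet_Ioo]
  refine measure_mono_null (fun x hx => ?_) hnull
  simp only [mem_compl_iff, mem_ofPred_eq, Classical.not_imp, not_not] at hx
  exact ⟨hx.2, Ioo_subset_Ioo hu1 hv1 hx.1⟩

lemma sub_le_sub_of_density_comp_eq {f g : ℝ → ℝ≥0∞} (hf : Measurable f) (hg : Measurable g)
    {S T : ℝ → ℝ} (hS : Measurable S) (hT : Measurable T) (hSm : MonotoneOn S (Ioo 0 1))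
    (hTm : MonotoneOn T (Ioo 0 1)) (hSlaw : unif.map S = volume.withDensity f)
    (hTlaw : unif.map T = volume.withDensity g) (hfg : ∀ᵐ u ∂unif, f (S u) = g (T u))
    {α β : ℝ} (hα : α ∈ Ioo (0 : ℝ) 1) (hβ : β ∈ Ioo (0 : ℝ) 1) (hαβ : α ≤ β)
    (hpos : ∀ᵐ x ∂(volume.restrict (Ioo (S α) (S β))), f x ≠ 0) :
    S β - S α ≤ T β - T α := by
  have hfin : ∀ᵐ x, f x ≠ ∞ := by
    have : IsProbabilityMeasure (volume.withDensity f) :=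
      hSlaw ▸ Measure.isProbabilityMeasure_map hS.aemeasurable
    have h1 : ∫⁻ x, f x ≠ ∞ := by
      rw [← setLIntegral_univ, ← withDensity_apply _ MeasurableSet.univ]
      exact measure_ne_top _ _
    exact (ae_lt_top hf h1).mono fun x hx => hx.ne
  have h1 := le_setLIntegral_inv_density hf hS hSlaw (Icc α β ∩ Ioo 0 1) (S α) (S β) (by
    filter_upwards [ae_unif_mem] with u hu hSu
    refine ⟨⟨?_, ?_⟩, hu⟩
    · by_contra! hlt
      exact (hSm hu hα hlt.le).not_gt hSu.1
    · by_contra! hlt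
      exact (hSm hβ hu hlt.le).not_gt hSu.2)
    (measurableSet_Icc.inter measurableSet_Ioo) hpos hfin
  have h2 := setLIntegral_inv_density_le hg hT hTlaw (Icc α β ∩ Ioo 0 1) (T α) (T β)
    (fun u hu => ⟨hTm hα hu.2 hu.1.1, hTm hu.2 hβ hu.1.2⟩)
    (measurableSet_Icc.inter measurableSet_Ioo)
  have h3 : ∫⁻ u in Icc α β ∩ Ioo 0 1, (f (S u))⁻¹ ∂unif =
      ∫⁻ u in Icc α β ∩ Ioo 0 1, (g (T u))⁻¹ ∂unif := by
    refine lintegral_congr_ae (ae_restrict_of_ae ?_)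
    filter_upwards [hfg] with u hu
    rw [hu]
  exact (ENNReal.ofReal_le_ofReal_iff (sub_nonneg.2 (hTm hα hβ hαβ))).1 ((h1.trans h3.le).trans h2)

lemma exists_eq_add_of_density_comp_eq {f g : ℝ → ℝ≥0∞} (hf : Measurable f) (hg : Measurable g)
    {S T : ℝ → ℝ} (hS : Measurable S) (hT : Measurable T) (hSm : MonotoneOn S (Ioo 0 1))
    (hTm : MonotoneOn T (Ioo 0 1)) (hSlaw : unif.map S = volume.withDensity f)
    (hTlaw : unif.map T = volume.withDensity g) (hfg : ∀ᵐ u ∂unif, f (S u) = g (T u))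
    (hfi : ∀ a ∈ Ioo (0 : ℝ) 1, ∀ᵐ p ∂((volume.withDensity f).prod (volume.withDensity f)),
      a * p.1 + (1 - a) * p.2 ∉ {x | f x = 0})
    (hgi : ∀ a ∈ Ioo (0 : ℝ) 1, ∀ᵐ p ∂((volume.withDensity g).prod (volume.withDensity g)),
      a * p.1 + (1 - a) * p.2 ∉ {x | g x = 0}) :
    ∃ c : ℝ, volume.withDensity g = (volume.withDensity f).map (· + c) := by
  have key : ∀ α ∈ Ioo (0 : ℝ) 1, ∀ β ∈ Ioo (0 : ℝ) 1, α ≤ β → T β - T α = S β - S α :=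
    fun α hα β hβ hαβ => le_antisymm
      (sub_le_sub_of_density_comp_eq hg hf hT hS hTm hSm hTlaw hSlaw (hfg.mono fun _ h => h.symm)
        hα hβ hαβ (ae_density_ne_zero_of_interpolation hg hT hTm hTlaw hgi hα hβ))
      (sub_le_sub_of_density_comp_eq hf hg hS hT hSm hTm hSlaw hTlaw hfg hα hβ hαβ
        (ae_density_ne_zero_of_interpolation hf hS hSm hSlaw hfi hα hβ))
  have hh : (1 / 2 : ℝ) ∈ Ioo (0 : ℝ) 1 := by norm_num
  refine ⟨T (1 / 2) - S (1 / 2), ?_⟩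
  rw [← hSlaw, ← hTlaw, Measure.map_map (by fun_prop) hS]
  refine Measure.map_congr ?_
  filter_upwards [ae_unif_mem] with u hu
  simp only [Function.comp_apply]
  rcases le_total u (1 / 2) with h | h
  · linarith [key u hu _ hh h]
  · linarith [key _ hh u hu h]

end EntropyTransport

namespace EntropyTransport

open Set ProbabilityTheory

/-! ### Equality of the marginal Jacobians of two minimizers -/

/-- Orthonormal coordinates adapted to a unit vector. -/
lemma exists_coordinates {n : ℕ} {e : Ed (n + 1)} (he : ‖e‖ = 1) :
    ∃ Φ : (ℝ × (Fin n → ℝ)) ≃ᵐ Ed (n + 1), MeasurePreserving Φ ∧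
      (∀ x y, Φ ((1 / 2 : ℝ) • x + (1 / 2 : ℝ) • y) =
        (1 / 2 : ℝ) • Φ x + (1 / 2 : ℝ) • Φ y) ∧ ∀ q, (⟪Φ q, e⟫ : ℝ) = q.1 := by
  have hv : Orthonormal ℝ (({0} : Set (Fin (n + 1))).domRestrict fun _ => e) := by
    refine ⟨fun _ => he, fun i j hij => absurd (Subsingleton.elim i j) hij⟩
  obtain ⟨b, hb⟩ := hv.exists_orthonormalBasis_extension_of_card_eq (by simp)
  have hb0 : b 0 = e := hb 0 rfl
  refine ⟨((MeasurableEquiv.piFinSuccAbove (fun _ : Fin (n + 1) => ℝ) 0).symm.trans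
    (MeasurableEquiv.toLp 2 (Fin (n + 1) → ℝ))).trans b.repr.symm.toMeasurableEquiv, ?_, ?_, ?_⟩
  · exact ((volume_preserving_piFinSuccAbove (fun _ : Fin (n + 1) => ℝ) 0).symm.trans
      (PiLp.volume_preserving_toLp (Fin (n + 1)))).trans b.measurePreserving_repr_symm
  · intro x y
    have hlin : WithLp.toLp 2 ((MeasurableEquiv.piFinSuccAbove (fun _ : Fin (n + 1) => ℝ) 0).symm
        ((1 / 2 : ℝ) • x + (1 / 2 : ℝ) • y)) =
        (1 / 2 : ℝ) • WithLp.toLp 2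
          ((MeasurableEquiv.piFinSuccAbove (fun _ : Fin (n + 1) => ℝ) 0).symm x) +
        (1 / 2 : ℝ) • WithLp.toLp 2
          ((MeasurableEquiv.piFinSuccAbove (fun _ : Fin (n + 1) => ℝ) 0).symm y) := by
      ext i
      refine Fin.cases ?_ (fun j => ?_) i <;> simp [MeasurableEquiv.piFinSuccAbove]
    have h := congrArg b.repr.symm hlin
    rw [b.repr.symm.map_add, b.repr.symm.map_smul, b.repr.symm.map_smul] at h
    exact h
  · intro q
    have h := b.repr_apply_apply (b.repr.symm (WithLp.toLp 2
      ((MeasurableEquiv.piFinSuccAbove (fun _ : Fin (n + 1) => ℝ) 0).symm q))) 0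
    rw [hb0, LinearIsometryEquiv.apply_symm_apply, real_inner_comm] at h
    refine h.symm.trans ?_
    simp [MeasurableEquiv.piFinSuccAbove]

lemma sq_mul_mul_eq_ofReal_exp {s f g : ℝ≥0∞} (hs : s ≠ 0 ∧ s ≠ ∞) (hf : f ≠ 0 ∧ f ≠ ∞)
    (hg : g ≠ 0 ∧ g ≠ ∞) : s ^ 2 * f * g = ENNReal.ofReal
      (exp (2 * Real.log s.toReal + Real.log f.toReal + Real.log g.toReal)) := by
  have hs' := ENNReal.toReal_pos hs.1 hs.2
  have hf' := ENNReal.toReal_pos hf.1 hf.2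
  have hg' := ENNReal.toReal_pos hg.1 hg.2
  rw [Real.exp_add, Real.exp_add, two_mul, Real.exp_add, Real.exp_log hs', Real.exp_log hf',
    Real.exp_log hg', ← sq, ENNReal.ofReal_mul (by positivity), ENNReal.ofReal_mul (by positivity),
    ENNReal.ofReal_pow hs'.le, ENNReal.ofReal_toReal hs.2, ENNReal.ofReal_toReal hf.2,
    ENNReal.ofReal_toReal hg.2]

variable {d : ℕ}

open Classical in
/-- A coupling of two minimizers as in `IsMidTransport` is extremal. -/
lemma IsMinimizer.sq_mul_mul_le_one {μ : Measure (Ed d)} [IsProbabilityMeasure μ]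
    (hμ : FirstMoment μ) {m : ℝ} {ρ₀ ρ₁ : Measure (Ed d)} (h₀ : IsMinimizer μ m ρ₀)
    (h₁ : IsMinimizer μ m ρ₁) {B : Type} [MeasurableSpace B] {P : Measure B}
    [IsProbabilityMeasure P] {X Y : B → Ed d} {s : B → ℝ≥0∞} (hX : Measurable X)
    (hY : Measurable Y) (hs : Measurable s)
    (h : IsMidTransport P (ρ₀.rnDeriv volume) (ρ₁.rnDeriv volume) X Y s) :
    ∀ᵐ u ∂P, s u ^ 2 * ρ₀.rnDeriv volume (X u) * ρ₁.rnDeriv volume (Y u) ≤ 1 := by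
  have := h₀.prob
  have := h₁.prob
  have hl₀ := measurable_logDens ρ₀
  have hl₁ := measurable_logDens ρ₁
  have hX₀ : P.map X = ρ₀ := h.map_left.trans (Measure.withDensity_rnDeriv_eq _ _ h₀.ac)
  have hY₁ : P.map Y = ρ₁ := h.map_right.trans (Measure.withDensity_rnDeriv_eq _ _ h₁.ac)
  have hne₀ : ∀ᵐ u ∂P, ρ₀.rnDeriv volume (X u) ≠ 0 ∧ ρ₀.rnDeriv volume (X u) ≠ ∞ := by
    have := ae_rnDeriv_ne h₀.ac
    rw [← hX₀] at this
    simpa only [hX₀] using ae_of_ae_map hX.aemeasurable this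
  have hne₁ : ∀ᵐ u ∂P, ρ₁.rnDeriv volume (Y u) ≠ 0 ∧ ρ₁.rnDeriv volume (Y u) ≠ ∞ := by
    have := ae_rnDeriv_ne h₁.ac
    rw [← hY₁] at this
    simpa only [hY₁] using ae_of_ae_map hY.aemeasurable this
  have hi₀ : Integrable (fun u => logDens ρ₀ (X u)) P := by
    refine (integrable_map_measure (f := X) hl₀.aestronglyMeasurable hX.aemeasurable).1 ?_
    rw [hX₀]
    exact h₀.integrable
  have hi₁ : Integrable (fun u => logDens ρ₁ (Y u)) P := by
    refine (integrable_map_measure (f := Y) hl₁.aestronglyMeasurable hY.aemeasurable).1 ?_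
    rw [hY₁]
    exact h₁.integrable
  obtain ⟨c, hc⟩ : ∃ c : B → ℝ, c = fun u => 1 / 2 * logDens ρ₀ (X u) + 1 / 2 * logDens ρ₁ (Y u) :=
    ⟨_, rfl⟩
  have hcm : Measurable c := by rw [hc]; fun_prop
  have hci : Integrable c P := by rw [hc]; exact (hi₀.const_mul _).add (hi₁.const_mul _)
  obtain ⟨r, hr⟩ : ∃ r : B → ℝ, r = fun u => if s u = ∞ then c u - 1 else
    max (-Real.log (s u).toReal) (c u - 1) := ⟨_, rfl⟩
  have hrm : Measurable r := by
    rw [hr]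
    exact Measurable.ite (hs (measurableSet_singleton ∞)) (by fun_prop)
      (hs.ennreal_toReal.log.neg.max (hcm.sub_const 1))
  have hs0 : ∀ᵐ u ∂P, s u ≠ 0 := by
    filter_upwards [h.one_le] with u hu h0
    simp [h0] at hu
  have hrc : ∀ᵐ u ∂P, r u ≤ c u := by
    filter_upwards [h.one_le, hs0, hne₀, hne₁] with u h1 hu0 hu1 hu2
    rw [hr]
    by_cases hst : s u = ∞
    · simp [hst]
    · simp only [hst, if_false]
      rw [sq_mul_mul_eq_ofReal_exp ⟨hu0, hst⟩ hu1 hu2, ENNReal.one_le_ofReal, Real.one_le_exp_iff]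
        at h1
      refine max_le ?_ (by linarith)
      rw [hc]
      simp only [logDens]
      linarith
  have hcr : ∀ u, c u - 1 ≤ r u := by
    intro u
    rw [hr]
    by_cases hst : s u = ∞
    · simp [hst]
    · simp [hst]
  have hri : Integrable r P := by
    refine (hci.norm.add (integrable_const 1)).mono' hrm.aestronglyMeasurable ?_
    filter_upwards [hrc] with u hu
    simp only [Pi.add_apply, Real.norm_eq_abs]
    rw [abs_le]
    have h1 := hcr u
    have h2 := le_abs_self (c u)
    have h3 := neg_abs_le (c u)
    constructor <;> linarith
  have key := IsMinimizer.le_integral hμ hX hY (hX₀.symm ▸ h₀) (hY₁.symm ▸ h₁)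
    (a := 1 / 2) (b := 1 / 2) (by norm_num) (by norm_num) (by norm_num) hri fun φ hφ => by
      refine le_trans (lintegral_mono_ae ?_) (h.lintegral_le φ hφ)
      filter_upwards [hs0] with u hu0
      gcongr
      by_cases hst : s u = ∞
      · simp [hst]
      · have hpos := ENNReal.toReal_pos hu0 hst
        rw [← ENNReal.ofReal_toReal hst]
        refine ENNReal.ofReal_le_ofReal ?_
        rw [← Real.exp_log hpos]
        refine Real.exp_le_exp.2 ?_
        have : -Real.log (s u).toReal ≤ r u := by
          rw [hr]
          simp [hst]
        linarith
  rw [hX₀, hY₁, ← integral_const_mul, ← integral_const_mul,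
    ← integral_add (hi₀.const_mul _) (hi₁.const_mul _)] at key
  have heq : r =ᵐ[P] c := by
    refine (integral_eq_iff_of_ae_le hri hci hrc).1 (le_antisymm (integral_mono_ae hri hci hrc) ?_)
    rw [hc]
    exact key
  filter_upwards [heq, hs0, hne₀, hne₁] with u hu hu0 hu1 hu2
  have hst : s u ≠ ∞ := by
    intro hst
    rw [hr] at hu
    simp [hst] at hu
  rw [sq_mul_mul_eq_ofReal_exp ⟨hu0, hst⟩ hu1 hu2, ENNReal.ofReal_le_one, Real.exp_le_one_iff]
  have h1 : -Real.log (s u).toReal ≤ c u := by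
    rw [← hu, hr]
    simp [hst]
  have h2 : c u ≤ -Real.log (s u).toReal := by
    rw [hr] at hu
    simp only [hst, if_false] at hu
    rcases max_choice (-Real.log (s u).toReal) (c u - 1) with h | h
    · rw [h] at hu
      exact hu.ge
    · rw [h] at hu
      linarith
  rw [hc] at h2
  simp only [logDens] at h2
  linarith

end EntropyTransport

namespace EntropyTransport

open Set ProbabilityTheory

/-! ### Translation of minimizers -/

lemma map_inner_eq_withDensity {n : ℕ} {ρ : Measure (Ed (n + 1))} [SigmaFinite ρ]
    (hρ : ρ ≪ volume) {e : Ed (n + 1)} (Φ : (ℝ × (Fin n → ℝ)) ≃ᵐ Ed (n + 1))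
    (hΦ : MeasurePreserving Φ) (hΦe : ∀ q, (⟪Φ q, e⟫ : ℝ) = q.1) :
    ρ.map (fun x => (⟪x, e⟫ : ℝ)) =
      volume.withDensity (margDensity fun q => ρ.rnDeriv volume (Φ q)) := by
  have hd := Measure.measurable_rnDeriv ρ volume
  have hf : Measurable fun q => ρ.rnDeriv volume (Φ q) := hd.comp Φ.measurable
  refine Measure.ext_of_lintegral _ fun φ hφ => ?_
  have hin : Measurable fun x : Ed (n + 1) => (⟪x, e⟫ : ℝ) := by fun_prop
  have hφi : Measurable fun x : Ed (n + 1) => φ (⟪x, e⟫ : ℝ) := hφ.comp hin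
  have hφ2 : Measurable fun x => ρ.rnDeriv volume x * φ (⟪x, e⟫ : ℝ) := hd.mul hφi
  have hφ3 : Measurable fun q : ℝ × (Fin n → ℝ) => ρ.rnDeriv volume (Φ q) * φ q.1 :=
    hf.mul (hφ.comp measurable_fst)
  rw [lintegral_map hφ hin, ← lintegral_rnDeriv_mul hρ hφi, ← hΦ.lintegral_comp hφ2,
    lintegral_withDensity_mul _ (measurable_margDensity_single hf) hφ]
  simp_rw [hΦe]
  rw [Measure.volume_eq_prod, lintegral_prod _ hφ3.aemeasurable]
  refine lintegral_congr fun x => ?_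
  have hfx : Measurable fun y => ρ.rnDeriv volume (Φ (x, y)) := hf.comp measurable_prodMk_left
  rw [margDensity]
  exact lintegral_mul_const (φ x) hfx

lemma IsMinimizer.ae_marginal_interpolation {d : ℕ} {μ : Measure (Ed d)} [IsProbabilityMeasure μ]
    (hμ : FirstMoment μ) {m : ℝ} {ρ : Measure (Ed d)} (hρ : IsMinimizer μ m ρ) (e : Ed d)
    {f : ℝ → ℝ≥0∞} (hf : Measurable f)
    (hlaw : ρ.map (fun x => (⟪x, e⟫ : ℝ)) = volume.withDensity f) {a : ℝ}
    (ha : a ∈ Ioo (0 : ℝ) 1) :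
    ∀ᵐ p ∂((volume.withDensity f).prod (volume.withDensity f)),
      a * p.1 + (1 - a) * p.2 ∉ {x | f x = 0} := by
  have := hρ.prob
  have hin : Measurable fun x : Ed d => (⟪x, e⟫ : ℝ) := by fun_prop
  have hB : MeasurableSet {x | f x = 0} := hf (measurableSet_singleton 0)
  have hN0 : ρ ((fun x => (⟪x, e⟫ : ℝ)) ⁻¹' {x | f x = 0}) = 0 := by
    rw [← Measure.map_apply hin hB, hlaw, withDensity_apply _ hB,
      setLIntegral_congr_fun (g := fun _ => 0) hB fun x hx => hx, lintegral_zero]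
  have h := hρ.ae_interpolation_notMem hμ (hin hB) hN0 ha.1 (sub_pos.2 ha.2) (by ring)
  have hm : MeasurableSet {p : ℝ × ℝ | a * p.1 + (1 - a) * p.2 ∉ {x | f x = 0}} := by
    have : Measurable fun p : ℝ × ℝ => a * p.1 + (1 - a) * p.2 := by fun_prop
    exact this hB.compl
  rw [← hlaw, Measure.map_prod_map _ _ hin hin, ae_map_iff (hin.prodMap hin).aemeasurable hm]
  filter_upwards [h] with p hp
  simpa [inner_add_left, real_inner_smul_left] using hp

/-- The one-dimensional marginals of two minimizers are translates of each other. -/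
lemma IsMinimizer.exists_map_inner_eq {n : ℕ} {μ : Measure (Ed (n + 1))} [IsProbabilityMeasure μ]
    (hμ : FirstMoment μ) {m : ℝ} {ρ₀ ρ₁ : Measure (Ed (n + 1))} (h₀ : IsMinimizer μ m ρ₀)
    (h₁ : IsMinimizer μ m ρ₁) {e : Ed (n + 1)} (he : ‖e‖ = 1) :
    ∃ c : ℝ, ρ₁.map (fun x => (⟪x, e⟫ : ℝ)) =
      (ρ₀.map (fun x => (⟪x, e⟫ : ℝ))).map (· + c) := by
  have := h₀.prob
  have := h₁.prob
  obtain ⟨Φ, hΦ, hΦa, hΦe⟩ := exists_coordinates he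
  have hd₀ := Measure.measurable_rnDeriv ρ₀ volume
  have hd₁ := Measure.measurable_rnDeriv ρ₁ volume
  have hf : Measurable fun q => ρ₀.rnDeriv volume (Φ q) := hd₀.comp Φ.measurable
  have hg : Measurable fun q => ρ₁.rnDeriv volume (Φ q) := hd₁.comp Φ.measurable
  have hone : ∀ ρ : Measure (Ed (n + 1)), IsProbabilityMeasure ρ → ρ ≪ volume →
      ∫⁻ q, ρ.rnDeriv volume (Φ q) = 1 := fun ρ _ hρ => by
    rw [hΦ.lintegral_comp (Measure.measurable_rnDeriv ρ volume), Measure.lintegral_rnDeriv hρ,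
      measure_univ]
  obtain ⟨B, _, P, _, hP⟩ := hasMidTransport_pi n
  obtain ⟨X, Y, s, hX, hY, hs, h, hX1, hY1, heq⟩ :=
    exists_isMidTransport_prod hP hf hg (hone ρ₀ h₀.prob h₀.ac) (hone ρ₁ h₁.prob h₁.ac)
  have hle := h₀.sq_mul_mul_le_one hμ h₁ (Φ.measurable.comp hX) (Φ.measurable.comp hY) hs
    (h.map_equiv hd₀ hd₁ hX hY Φ hΦ hΦa)
  obtain ⟨f, hfdef⟩ : ∃ f, f = margDensity fun q => ρ₀.rnDeriv volume (Φ q) := ⟨_, rfl⟩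
  obtain ⟨g, hgdef⟩ : ∃ g, g = margDensity fun q => ρ₁.rnDeriv volume (Φ q) := ⟨_, rfl⟩
  have hfm : Measurable f := hfdef ▸ measurable_margDensity_single hf
  have hgm : Measurable g := hgdef ▸ measurable_margDensity_single hg
  have hlf := map_inner_eq_withDensity h₀.ac Φ hΦ hΦe
  have hlg := map_inner_eq_withDensity h₁.ac Φ hΦ hΦe
  rw [← hfdef] at hX1 hlf heq
  rw [← hgdef] at hY1 hlg heq
  have hin : Measurable fun x : Ed (n + 1) => (⟪x, e⟫ : ℝ) := by fun_prop
  have : IsProbabilityMeasure (volume.withDensity f) :=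
    hlf ▸ Measure.isProbabilityMeasure_map hin.aemeasurable
  have : IsProbabilityMeasure (volume.withDensity g) :=
    hlg ▸ Measure.isProbabilityMeasure_map hin.aemeasurable
  have hfg : ∀ᵐ u ∂unif, f (quantile (volume.withDensity f) u) =
      g (quantile (volume.withDensity g) u) := by
    have h1 : ∀ᵐ p ∂(unif.prod P), f (quantile (volume.withDensity f) p.1) =
        g (quantile (volume.withDensity g) p.1) := by
      filter_upwards [heq, hle] with p hp hp'
      rw [← hX1, ← hY1]
      exact hp hp'
    filter_upwards [Measure.ae_ae_of_ae_prod h1] with u hu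
    exact hu.exists.choose_spec
  rw [hlf, hlg]
  exact exists_eq_add_of_density_comp_eq hfm hgm (measurable_quantile_single _)
    (measurable_quantile_single _) (quantile_mono _) (quantile_mono _) (map_quantile _)
    (map_quantile _) hfg (fun a ha => h₀.ae_marginal_interpolation hμ e hfm hlf ha)
    (fun a ha => h₁.ae_marginal_interpolation hμ e hgm hlg ha)

/-- Cramér–Wold device. -/
lemma ext_of_map_inner {d : ℕ} {ρ σ : Measure (Ed d)} [IsProbabilityMeasure ρ]
    [IsProbabilityMeasure σ] (h : ∀ e : Ed d, ‖e‖ = 1 →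
      ρ.map (fun x => (⟪x, e⟫ : ℝ)) = σ.map (fun x => (⟪x, e⟫ : ℝ))) : ρ = σ := by
  refine Measure.ext_of_charFun (funext fun t => ?_)
  rcases eq_or_ne t 0 with rfl | ht
  · simp
  have hn : ‖t‖ ≠ 0 := norm_ne_zero_iff.2 ht
  have key : ∀ τ : Measure (Ed d), charFun τ t =
      charFun (τ.map fun x => (⟪x, ‖t‖⁻¹ • t⟫ : ℝ)) ‖t‖ := by
    intro τ
    rw [charFun_apply_real, integral_map (by fun_prop) (by fun_prop), charFun_apply]
    refine integral_congr_ae (ae_of_all _ fun x => ?_)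
    have : (⟪x, t⟫ : ℝ) = ‖t‖ * ⟪x, ‖t‖⁻¹ • t⟫ := by
      rw [real_inner_smul_right, mul_inv_cancel_left₀ hn]
    simp only [this, Complex.ofReal_mul]
  rw [key ρ, key σ, h]
  rw [norm_smul, norm_inv, norm_norm, inv_mul_cancel₀ hn]

lemma eq_map_add_of_map_inner {d : ℕ} {ρ₀ ρ₁ : Measure (Ed d)} [IsProbabilityMeasure ρ₀]
    [IsProbabilityMeasure ρ₁] (h₀ : FirstMoment ρ₀) (h₁ : FirstMoment ρ₁)
    (h : ∀ e : Ed d, ‖e‖ = 1 → ∃ c : ℝ, ρ₁.map (fun x => (⟪x, e⟫ : ℝ)) =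
      (ρ₀.map (fun x => (⟪x, e⟫ : ℝ))).map (· + c)) :
    ρ₁ = ρ₀.map (fun x => x + (∫ x, x ∂ρ₁ - ∫ x, x ∂ρ₀)) := by
  have hi₀ : Integrable (fun x => x) ρ₀ :=
    (integrable_norm_iff aestronglyMeasurable_id).1 h₀
  have hi₁ : Integrable (fun x => x) ρ₁ :=
    (integrable_norm_iff aestronglyMeasurable_id).1 h₁
  have : IsProbabilityMeasure (ρ₀.map (fun x => x + (∫ x, x ∂ρ₁ - ∫ x, x ∂ρ₀))) :=
    Measure.isProbabilityMeasure_map (by fun_prop)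
  refine ext_of_map_inner fun e he => ?_
  obtain ⟨c, hc⟩ := h e he
  have hin : Measurable fun x : Ed d => (⟪x, e⟫ : ℝ) := by fun_prop
  have hmean : ∀ ρ : Measure (Ed d), Integrable (fun x => x) ρ →
      ∫ x, (⟪x, e⟫ : ℝ) ∂ρ = ⟪∫ x, x ∂ρ, e⟫ := fun ρ hρ => by
    simp_rw [real_inner_comm e]
    exact integral_inner hρ e
  have hc' : ⟪∫ x, x ∂ρ₁, e⟫ = ⟪∫ x, x ∂ρ₀, e⟫ + c := by
    have h2 := congrArg (fun ν : Measure ℝ => ∫ t, t ∂ν) hc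
    rw [integral_map hin.aemeasurable (by fun_prop), integral_map (by fun_prop) (by fun_prop),
      integral_map hin.aemeasurable (by fun_prop),
      integral_add (hi₀.inner_const e) (integrable_const c), hmean _ hi₀, hmean _ hi₁] at h2
    simpa using h2
  rw [hc, Measure.map_map (by fun_prop) hin, Measure.map_map hin (by fun_prop)]
  congr 1
  funext x
  simp only [Function.comp_apply, inner_add_left, inner_sub_left]
  linarith

end EntropyTransport

/-- uniqueness of the minimizer of `E(·) + T(·,μ)` up to translations. -/
theorem minimizer_unique_up_to_translation {d : ℕ} (hd : 1 ≤ d)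
    (μ : Measure (Ed d)) [IsProbabilityMeasure μ] (hμ1 : FirstMoment μ) (hμc : Centered μ)
    (hμH : ¬ ∃ e : Ed d, ∃ ℓ : ℝ, ‖e‖ = 1 ∧ μ {y | (⟪y, e⟫ : ℝ) = ℓ} = 1)
    (ρ₀ ρ₁ : Measure (Ed d)) [IsProbabilityMeasure ρ₀] [IsProbabilityMeasure ρ₁]
    (hρ₀1 : FirstMoment ρ₀) (hρ₁1 : FirstMoment ρ₁)
    (hmin₀ : ∀ ρ : Measure (Ed d), IsProbabilityMeasure ρ → FirstMoment ρ →
      entropy ρ₀ + maxCorr ρ₀ μ ≤ entropy ρ + maxCorr ρ μ)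
    (hmin₁ : ∀ ρ : Measure (Ed d), IsProbabilityMeasure ρ → FirstMoment ρ →
      entropy ρ₁ + maxCorr ρ₁ μ ≤ entropy ρ + maxCorr ρ μ) :
    ∃ w : Ed d, ρ₁ = ρ₀.map (fun x => x + w) := by
  obtain ⟨m, hm, h₀⟩ := EntropyTransport.exists_isMinimizer hμ1 hρ₀1 hmin₀
  obtain ⟨m', hm', h₁⟩ := EntropyTransport.exists_isMinimizer hμ1 hρ₁1 hmin₁
  have hmm : m' = m := by
    rw [← EReal.coe_eq_coe_iff, ← hm, ← hm']
    exact le_antisymm (hmin₁ ρ₀ inferInstance hρ₀1) (hmin₀ ρ₁ inferInstance hρ₁1)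
  subst hmm
  obtain ⟨n, rfl⟩ : ∃ n, d = n + 1 := ⟨d - 1, by omega⟩
  exact ⟨_, EntropyTransport.eq_map_add_of_map_inner hρ₀1 hρ₁1 fun e he =>
    h₀.exists_map_inner_eq hμ1 h₁ he⟩
end
end
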